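/- Every d-dimensional polytope with exactly d+2 vertices is projectively equivalent to the k-fold pyramid over the direct sum Δ_n ⊕ Δ_m of two simplices, for some integers k ≥ 0 and n, m ≥ 1 with k+n+m = d. Dually, every d-dimensional polytope with exactly d+2 facets is projectively equivalent to the k-fold pyramid over the product Δ_n × Δ_m, for some k ≥ 0 and n, m ≥ 1 with k+n+m = d. -/

import Mathlib

open Set

noncomputable section

/-- A polytope: the convex hull of a finite set of points. -/
def IsPolytope {N : ℕ} (P : Set (Fin N → ℝ)) : Prop :=
  ∃ S : Finset (Fin N → ℝ), P = convexHull ℝ (S : Set (Fin N → ℝ))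

/-- Dimension of a set: the dimension of its affine hull (with `-1` for the empty set). -/
def pdim {N : ℕ} (P : Set (Fin N → ℝ)) : ℤ :=
  haveI := Classical.dec P.Nonempty
  if P.Nonempty then (Module.finrank ℝ (affineSpan ℝ P).direction : ℤ) else -1

/-- `F` is a face of `P`: the subset of `P` where some linear functional bounded above on `P`
attains its maximum value.  This includes `∅` and `P` itself. -/
def IsFaceOf {N : ℕ} (F P : Set (Fin N → ℝ)) : Prop :=
  ∃ (c : Fin N → ℝ) (b : ℝ),
    (∀ x ∈ P, ∑ i, c i * x i ≤ b) ∧ F = {x ∈ P | ∑ i, c i * x i = b}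

/-- A facet: a face of dimension one less than the polytope. -/
def IsFacetOf {N : ℕ} (F P : Set (Fin N → ℝ)) : Prop :=
  IsFaceOf F P ∧ pdim F + 1 = pdim P

/-- A ridge: a face of dimension two less than the polytope. -/
def IsRidgeOf {N : ℕ} (F P : Set (Fin N → ℝ)) : Prop :=
  IsFaceOf F P ∧ pdim F + 2 = pdim P

def IsVertexOf {N : ℕ} (v : Fin N → ℝ) (P : Set (Fin N → ℝ)) : Prop :=
  IsFaceOf {v} P

def vertexSet {N : ℕ} (P : Set (Fin N → ℝ)) : Set (Fin N → ℝ) :=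
  {v | IsVertexOf v P}

def vertexCount {N : ℕ} (P : Set (Fin N → ℝ)) : ℕ := (vertexSet P).ncard

def facetCount {N : ℕ} (P : Set (Fin N → ℝ)) : ℕ := {F | IsFacetOf F P}.ncard

/-- Extension complexity: the minimal number of facets of a polytope (in any dimension)
admitting an affine projection onto `P`. -/
def xc {N : ℕ} (P : Set (Fin N → ℝ)) : ℕ :=
  sInf {n | ∃ (e : ℕ) (Q : Set (Fin e → ℝ)) (π : (Fin e → ℝ) →ᵃ[ℝ] (Fin N → ℝ)),
    IsPolytope Q ∧ π '' Q = P ∧ facetCount Q = n}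

/-- Combinatorial equivalence: an inclusion-preserving bijection between face lattices. -/
def CombEquiv {M N : ℕ} (P : Set (Fin M → ℝ)) (Q : Set (Fin N → ℝ)) : Prop :=
  ∃ φ : {F : Set (Fin M → ℝ) // IsFaceOf F P} ≃ {G : Set (Fin N → ℝ) // IsFaceOf G Q},
    ∀ F₁ F₂ : {F : Set (Fin M → ℝ) // IsFaceOf F P},
      F₁.1 ⊆ F₂.1 ↔ (φ F₁).1 ⊆ (φ F₂).1

/-- A full-dimensional `n`-simplex in `ℝ^n` with the origin in its (relative) interior. -/
def simplexF (n : ℕ) : Set (Fin n → ℝ) :=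
  convexHull ℝ ((Set.range fun i : Fin n => Pi.single i (1 : ℝ)) ∪ {fun _ => -1})

/-- The Cartesian product `Δ_n × Δ_m`, realized in `ℝ^{n+m}`. -/
def prodP (n m : ℕ) : Set (Fin (n + m) → ℝ) :=
  {z | ∃ a ∈ simplexF n, ∃ b ∈ simplexF m, z = Fin.append a b}

/-- The direct sum `Δ_n ⊕ Δ_m`, realized in `ℝ^{n+m}`. -/
def sumP (n m : ℕ) : Set (Fin (n + m) → ℝ) :=
  convexHull ℝ (((fun a : Fin n → ℝ => Fin.append a (0 : Fin m → ℝ)) '' simplexF n) ∪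
    ((fun b : Fin m → ℝ => Fin.append (0 : Fin n → ℝ) b) '' simplexF m))

/-- The join `A ⋆ B` of two polytopes, realized in `ℝ^{p+q+1}` with the two copies
placed in skew affine subspaces. -/
def joinP {p q : ℕ} (A : Set (Fin p → ℝ)) (B : Set (Fin q → ℝ)) :
    Set (Fin (p + q + 1) → ℝ) :=
  convexHull ℝ
    (((fun a : Fin p → ℝ =>
        Fin.append (Fin.append a (0 : Fin q → ℝ)) (fun _ : Fin 1 => (0 : ℝ))) '' A) ∪
     ((fun b : Fin q → ℝ =>
        Fin.append (Fin.append (0 : Fin p → ℝ) b) (fun _ : Fin 1 => (1 : ℝ))) '' B))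

/-- The canonical `k`-fold iterated pyramid over `X`, realized in `ℝ^{p+k}`. -/
def pyrK {p : ℕ} (k : ℕ) (X : Set (Fin p → ℝ)) : Set (Fin (p + k) → ℝ) :=
  convexHull ℝ (((fun x : Fin p → ℝ => Fin.append x (0 : Fin k → ℝ)) '' X) ∪
    Set.range (fun j : Fin k => Fin.append (0 : Fin p → ℝ) (Pi.single j (1 : ℝ))))

/-- Transport a subset of `ℝ^a` to `ℝ^b` along a proof that `a = b`. -/
def castSet {a b : ℕ} (h : a = b) (X : Set (Fin a → ℝ)) : Set (Fin b → ℝ) :=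
  (fun x : Fin a → ℝ => fun i : Fin b => x (Fin.cast h.symm i)) '' X

/-- Projective equivalence of two subsets of `ℝ^N`: `Q` is the image of `P` under a
projective transformation `x ↦ (A x + b) / (⟨c, x⟩ + δ)` whose associated
`(N+1) × (N+1)` matrix is invertible and whose denominator is positive on `P`. -/
def ProjEquiv {N : ℕ} (P Q : Set (Fin N → ℝ)) : Prop :=
  ∃ (A : (Fin N → ℝ) →ₗ[ℝ] (Fin N → ℝ)) (b c : Fin N → ℝ) (δ : ℝ),
    Function.Bijective
      (fun z : (Fin N → ℝ) × ℝ => (A z.1 + z.2 • b, (∑ i, c i * z.1 i) + δ * z.2)) ∧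
    (∀ x ∈ P, 0 < (∑ i, c i * x i) + δ) ∧
    Q = (fun x : Fin N → ℝ => ((∑ i, c i * x i) + δ)⁻¹ • (A x + b)) '' P

/-- `P` is a pyramid with base `B`: the convex hull of `B` and a point outside
the affine hull of `B`. -/
def IsPyramidOver {N : ℕ} (P B : Set (Fin N → ℝ)) : Prop :=
  ∃ a : Fin N → ℝ, a ∉ affineSpan ℝ B ∧ P = convexHull ℝ (B ∪ {a})

/-- `P` is a `k`-fold iterated pyramid over `B`. -/
def IsKFoldPyramidOver {N : ℕ} : ℕ → Set (Fin N → ℝ) → Set (Fin N → ℝ) → Prop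
  | 0, P, B => P = B
  | k + 1, P, B => ∃ P' : Set (Fin N → ℝ), IsPyramidOver P P' ∧ IsKFoldPyramidOver k P' B

/-- `P` is a pyramid: the convex hull of one of its facets together with one more vertex. -/
def IsPyramidPolytope {N : ℕ} (P : Set (Fin N → ℝ)) : Prop :=
  ∃ (F : Set (Fin N → ℝ)) (v : Fin N → ℝ),
    IsFacetOf F P ∧ IsVertexOf v P ∧ P = convexHull ℝ (F ∪ {v})

/-- A facet is pyramidal if it contains all vertices of the polytope but one. -/
def IsPyramidalFacet {N : ℕ} (F P : Set (Fin N → ℝ)) : Prop :=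
  IsFacetOf F P ∧ ∃ v, IsVertexOf v P ∧ v ∉ F ∧ ∀ w, IsVertexOf w P → w ≠ v → w ∈ F

/-- The projection `π_d : ℝ^{d+1} → ℝ^d` forgetting the last coordinate. -/
def projFun (d : ℕ) : (Fin (d + 1) → ℝ) → (Fin d → ℝ) :=
  fun x i => x i.castSucc

/-- `c` is an outer normal vector exposing the face `F` of `Q`. -/
def IsOuterNormal {N : ℕ} (Q F : Set (Fin N → ℝ)) (c : Fin N → ℝ) : Prop :=
  ∃ b : ℝ, (∀ x ∈ Q, ∑ i, c i * x i ≤ b) ∧ F = {x ∈ Q | ∑ i, c i * x i = b}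

/-- An upper facet: outer normal with positive last coordinate. -/
def IsUpperFacet {d : ℕ} (F Q : Set (Fin (d + 1) → ℝ)) : Prop :=
  IsFacetOf F Q ∧ ∃ c, IsOuterNormal Q F c ∧ 0 < c (Fin.last d)

/-- A lower facet: outer normal with negative last coordinate. -/
def IsLowerFacet {d : ℕ} (F Q : Set (Fin (d + 1) → ℝ)) : Prop :=
  IsFacetOf F Q ∧ ∃ c, IsOuterNormal Q F c ∧ c (Fin.last d) < 0

/-- A vertical facet: every outer normal has vanishing last coordinate. -/
def IsVerticalFacet {d : ℕ} (F Q : Set (Fin (d + 1) → ℝ)) : Prop :=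
  IsFacetOf F Q ∧ ∀ c, IsOuterNormal Q F c → c (Fin.last d) = 0

/-- An equatorial ridge: a ridge that is the intersection of an upper and a lower facet. -/
def IsEquatorialRidge {d : ℕ} (F Q : Set (Fin (d + 1) → ℝ)) : Prop :=
  IsRidgeOf F Q ∧ ∃ F₁ F₂ : Set (Fin (d + 1) → ℝ),
    IsUpperFacet F₁ Q ∧ IsLowerFacet F₂ Q ∧ F = F₁ ∩ F₂

/-- A face `F` of `Q` is preserved under the projection forgetting the last coordinate. -/
def PreservedFace {d : ℕ} (Q F : Set (Fin (d + 1) → ℝ)) : Prop :=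
  IsFaceOf (projFun d '' F) (projFun d '' Q) ∧ projFun d ⁻¹' (projFun d '' F) ∩ Q = F

/-- A face `F` of `Q` is strictly preserved: preserved and of the same dimension as its image. -/
def StrictlyPreservedFace {d : ℕ} (Q F : Set (Fin (d + 1) → ℝ)) : Prop :=
  PreservedFace Q F ∧ pdim (projFun d '' F) = pdim F

/-- A hexagon: a 2-dimensional polytope with exactly 6 vertices. -/
def IsHexagon {N : ℕ} (P : Set (Fin N → ℝ)) : Prop :=
  IsPolytope P ∧ pdim P = 2 ∧ vertexCount P = 6

/-- Three lines are concurrent: they share a common point, or they are pairwise parallel. -/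
def ConcurrentLines {N : ℕ} (L₁ L₂ L₃ : AffineSubspace ℝ (Fin N → ℝ)) : Prop :=
  (∃ x, x ∈ L₁ ∧ x ∈ L₂ ∧ x ∈ L₃) ∨
    (AffineSubspace.Parallel L₁ L₂ ∧ AffineSubspace.Parallel L₂ L₃ ∧
      AffineSubspace.Parallel L₁ L₃)

/-- A cyclic labeling of the vertices of a hexagon: consecutive points are joined by edges. -/
def CyclicLabeling {N : ℕ} (P : Set (Fin N → ℝ)) (p : Fin 6 → (Fin N → ℝ)) : Prop :=
  Function.Injective p ∧ Set.range p = vertexSet P ∧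
    ∀ i : Fin 6, IsFaceOf (segment ℝ (p i) (p (i + 1))) P

/-- A Desarguian hexagon. -/
def Desarguian {N : ℕ} (P : Set (Fin N → ℝ)) : Prop :=
  ∃ p : Fin 6 → (Fin N → ℝ), CyclicLabeling P p ∧
    ConcurrentLines (affineSpan ℝ {p 0, p 1}) (affineSpan ℝ {p 5, p 2})
      (affineSpan ℝ {p 3, p 4})

/-- A polytope is simplicial if every facet is a simplex. -/
def IsSimplicial {N : ℕ} (P : Set (Fin N → ℝ)) : Prop :=
  ∀ F : Set (Fin N → ℝ), IsFacetOf F P →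
    ∃ S : Finset (Fin N → ℝ),
      AffineIndependent ℝ (Subtype.val : {x // x ∈ S} → (Fin N → ℝ)) ∧
      F = convexHull ℝ (S : Set (Fin N → ℝ))

theorem linearMap_apply_eq_sum_single {N : ℕ} (f : (Fin N → ℝ) →ₗ[ℝ] ℝ) (x : Fin N → ℝ) :
    f x = ∑ i, f (Pi.single i 1) * x i := by
  conv_lhs => rw [LinearMap.pi_apply_eq_sum_univ f x]
  refine Finset.sum_congr rfl fun i _ => ?_
  rw [smul_eq_mul, mul_comm]
  congr 2
  funext j
  simp [Pi.single_apply, eq_comm]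

/-- A linear automorphism of the homogenization that maps the cones over `P` and `Q` to each
other induces a projective equivalence. -/
theorem projEquiv_of_linearEquiv {N : ℕ} {P Q : Set (Fin N → ℝ)}
    (L : ((Fin N → ℝ) × ℝ) ≃ₗ[ℝ] ((Fin N → ℝ) × ℝ))
    (hP : ∀ x ∈ P, 0 < (L (x, 1)).2 ∧ ((L (x, 1)).2)⁻¹ • (L (x, 1)).1 ∈ Q)
    (hQ : ∀ y ∈ Q, 0 < (L.symm (y, 1)).2 ∧ ((L.symm (y, 1)).2)⁻¹ • (L.symm (y, 1)).1 ∈ P) :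
    ProjEquiv P Q := by
  set A : (Fin N → ℝ) →ₗ[ℝ] (Fin N → ℝ) :=
    LinearMap.fst ℝ _ _ ∘ₗ L.toLinearMap ∘ₗ LinearMap.inl ℝ _ _ with hA
  set b : Fin N → ℝ := (L (0, 1)).1 with hb
  set c : Fin N → ℝ := fun i => (L (Pi.single i 1, 0)).2 with hc
  set δ : ℝ := (L (0, 1)).2 with hδ
  have key (x : Fin N → ℝ) (t : ℝ) :
      L (x, t) = (A x + t • b, (∑ i, c i * x i) + δ * t) := by
    have h1 : ((x, t) : (Fin N → ℝ) × ℝ) = (x, 0) + t • (0, 1) := by simp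
    have h2 : (L (x, 0)).2 = ∑ i, c i * x i :=
      linearMap_apply_eq_sum_single
        (LinearMap.snd ℝ _ _ ∘ₗ L.toLinearMap ∘ₗ LinearMap.inl ℝ _ _) x
    rw [h1, map_add, map_smul]
    ext
    · simp [hA, hb]
    · simp [h2, hδ, mul_comm]
  have key1 (x : Fin N → ℝ) : L (x, 1) = (A x + b, (∑ i, c i * x i) + δ) := by
    rw [key, one_smul, mul_one]
  refine ⟨A, b, c, δ, ?_, ?_, ?_⟩
  · convert L.bijective using 1
    funext z
    exact (key z.1 z.2).symm
  · intro x hx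
    simpa [key1] using (hP x hx).1
  · ext y
    constructor
    · intro hy
      obtain ⟨h1, h2⟩ := hQ y hy
      refine ⟨_, h2, ?_⟩
      set z := L.symm (y, 1) with hz
      have hLz : L z = (y, 1) := by simp [hz]
      have h3 : ((z.2⁻¹ • z.1, 1) : (Fin N → ℝ) × ℝ) = z.2⁻¹ • z := by
        ext
        · simp
        · simp [h1.ne']
      have h4 := key1 (z.2⁻¹ • z.1)
      rw [h3, map_smul, hLz] at h4
      have h5 := congrArg Prod.fst h4
      have h6 := congrArg Prod.snd h4
      simp only [Prod.smul_mk, smul_eq_mul, mul_one] at h5 h6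
      change ((∑ i, c i * (z.2⁻¹ • z.1) i) + δ)⁻¹ • (A (z.2⁻¹ • z.1) + b) = y
      rw [← h5, ← h6, inv_inv, smul_smul, mul_inv_cancel₀ h1.ne', one_smul]
    · rintro ⟨x, hx, rfl⟩
      simpa [key1] using (hP x hx).2

/-- A linear map rescaling homogenized generators by positive factors maps the cone over one
convex hull to the cone over the other. -/
theorem homogenization_mapsTo_convexHull {V W ι : Type*} [AddCommGroup V] [Module ℝ V]
    [AddCommGroup W] [Module ℝ W] (L : (V × ℝ) →ₗ[ℝ] (W × ℝ)) {v : ι → V} {w : ι → W} {μ : ι → ℝ}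
    (hμ : ∀ i, 0 < μ i) (hL : ∀ i, L (v i, 1) = μ i • (w i, 1)) :
    ∀ x ∈ convexHull ℝ (range v),
      0 < (L (x, 1)).2 ∧ ((L (x, 1)).2)⁻¹ • (L (x, 1)).1 ∈ convexHull ℝ (range w) := by
  refine convexHull_min (s := range v)
    (t := {x | 0 < (L (x, 1)).2 ∧ ((L (x, 1)).2)⁻¹ • (L (x, 1)).1 ∈ convexHull ℝ (range w)}) ?_ ?_
  · rintro _ ⟨i, rfl⟩
    refine ⟨by simpa [hL] using hμ i, ?_⟩
    simp only [hL, Prod.smul_mk, smul_eq_mul, mul_one, smul_smul, inv_mul_cancel₀ (hμ i).ne',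
      one_smul]
    exact subset_convexHull _ _ ⟨i, rfl⟩
  · rintro x ⟨hx, hx'⟩ y ⟨hy, hy'⟩ a b ha hb hab
    have h1 : L (a • x + b • y, 1) = a • L (x, 1) + b • L (y, 1) := by
      rw [← map_smul, ← map_smul, ← map_add]
      congr 1
      ext <;> simp [hab]
    set X := L (x, 1)
    set Y := L (y, 1)
    have ht : 0 < a * X.2 + b * Y.2 := by
      rcases ha.eq_or_lt with rfl | ha
      · have : b = 1 := by linarith
        simpa [this] using hy
      · have := mul_pos ha hx
        have := mul_nonneg hb hy.le
        linarith
    refine ⟨by simpa [h1] using ht, ?_⟩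
    have h2 := convex_convexHull ℝ (range w) hx' hy'
      (a := (a * X.2 + b * Y.2)⁻¹ * (a * X.2)) (b := (a * X.2 + b * Y.2)⁻¹ * (b * Y.2))
      (by positivity) (by positivity) (by field_simp)
    convert h2 using 1
    simp only [h1, Prod.snd_add, Prod.smul_snd, smul_eq_mul, Prod.fst_add, Prod.smul_fst, smul_add,
      smul_smul]
    congr 2 <;> field_simp

theorem projEquiv_convexHull_range {N : ℕ} {ι : Type*} {v w : ι → Fin N → ℝ}
    (L : ((Fin N → ℝ) × ℝ) ≃ₗ[ℝ] ((Fin N → ℝ) × ℝ)) {μ : ι → ℝ} (hμ : ∀ i, 0 < μ i)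
    (hL : ∀ i, L (v i, 1) = μ i • (w i, 1)) :
    ProjEquiv (convexHull ℝ (range v)) (convexHull ℝ (range w)) := by
  refine projEquiv_of_linearEquiv L (homogenization_mapsTo_convexHull L.toLinearMap hμ hL)
    (homogenization_mapsTo_convexHull L.symm.toLinearMap (μ := fun i => (μ i)⁻¹)
      (fun i => inv_pos.2 (hμ i)) fun i => ?_)
  apply L.injective
  simp only [LinearEquiv.coe_coe, LinearEquiv.apply_symm_apply, map_smul, hL, smul_smul,
    inv_mul_cancel₀ (hμ i).ne', one_smul]

theorem projEquiv_of_nonneg {N : ℕ} {ι : Type*} {P Q : Set (Fin N → ℝ)}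
    {f g : ι → ((Fin N → ℝ) × ℝ) →ₗ[ℝ] ℝ}
    (L : ((Fin N → ℝ) × ℝ) ≃ₗ[ℝ] ((Fin N → ℝ) × ℝ)) {μ : ι → ℝ} (hμ : ∀ i, 0 < μ i)
    (hL : ∀ i z, g i (L z) = μ i * f i z)
    (hP : ∀ x, x ∈ P ↔ ∀ i, 0 ≤ f i (x, 1)) (hQ : ∀ x, x ∈ Q ↔ ∀ i, 0 ≤ g i (x, 1))
    (hf : ∀ z, (∀ i, 0 ≤ f i z) → z ≠ 0 → 0 < z.2)
    (hg : ∀ z, (∀ i, 0 ≤ g i z) → z ≠ 0 → 0 < z.2) : ProjEquiv P Q := by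
  have aux {R : Set (Fin N → ℝ)} {h : ι → ((Fin N → ℝ) × ℝ) →ₗ[ℝ] ℝ}
      (hR : ∀ x, x ∈ R ↔ ∀ i, 0 ≤ h i (x, 1))
      (hh : ∀ z, (∀ i, 0 ≤ h i z) → z ≠ 0 → 0 < z.2) (z : (Fin N → ℝ) × ℝ)
      (hz : ∀ i, 0 ≤ h i z) (hz0 : z ≠ 0) : 0 < z.2 ∧ z.2⁻¹ • z.1 ∈ R := by
    have h2 := hh z hz hz0
    refine ⟨h2, (hR _).2 fun i => ?_⟩
    have : ((z.2⁻¹ • z.1, 1) : (Fin N → ℝ) × ℝ) = z.2⁻¹ • z := by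
      ext
      · simp
      · simp [h2.ne']
    rw [this, map_smul, smul_eq_mul]
    exact mul_nonneg (inv_nonneg.2 h2.le) (hz i)
  refine projEquiv_of_linearEquiv L (fun x hx => ?_) (fun y hy => ?_)
  · refine aux hQ hg _ (fun i => ?_) (by simp)
    rw [hL]
    exact mul_nonneg (hμ i).le ((hP x).1 hx i)
  · refine aux hP hf _ (fun i => ?_) (by simp)
    refine nonneg_of_mul_nonneg_right ?_ (hμ i)
    rw [← hL, LinearEquiv.apply_symm_apply]
    exact (hQ y).1 hy i

/-- Reindexing the support of a sign vector with at least two entries of each sign. -/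
theorem exists_equiv_of_signs {ι : Type*} [Fintype ι] {d : ℕ} (hι : Fintype.card ι = d + 2)
    (l : ι → ℝ) (hpos : ∃ i j, i ≠ j ∧ 0 < l i ∧ 0 < l j)
    (hneg : ∃ i j, i ≠ j ∧ l i < 0 ∧ l j < 0) :
    ∃ (k n m : ℕ) (_ : n + m + k = d) (e : (Option (Fin n) ⊕ Option (Fin m)) ⊕ Fin k ≃ ι),
      1 ≤ n ∧ 1 ≤ m ∧ (∀ o, 0 < l (e (.inl (.inl o)))) ∧ (∀ o, l (e (.inl (.inr o))) < 0) ∧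
      ∀ j, l (e (.inr j)) = 0 := by
  classical
  obtain ⟨i, j, hij, hi, hj⟩ := hpos
  obtain ⟨i', j', hij', hi', hj'⟩ := hneg
  have h1 : 1 < Fintype.card {i // 0 < l i} :=
    Fintype.one_lt_card_iff.2 ⟨⟨i, hi⟩, ⟨j, hj⟩, by simpa using hij⟩
  have h2 : 1 < Fintype.card {i // l i < 0} :=
    Fintype.one_lt_card_iff.2 ⟨⟨i', hi'⟩, ⟨j', hj'⟩, by simpa using hij'⟩
  obtain ⟨n, hn⟩ := Nat.exists_eq_add_of_le' h1.le
  obtain ⟨m, hm⟩ := Nat.exists_eq_add_of_le' h2.le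
  let en : Option (Fin n) ≃ {i // 0 < l i} := Fintype.equivOfCardEq (by simp [hn])
  let em : Option (Fin m) ≃ {i // l i < 0} := Fintype.equivOfCardEq (by simp [hm])
  let ek : Fin (Fintype.card {i // l i = 0}) ≃ {i // l i = 0} := (Fintype.equivFin _).symm
  let F : (Option (Fin n) ⊕ Option (Fin m)) ⊕ Fin (Fintype.card {i // l i = 0}) → ι :=
    Sum.elim (Sum.elim (fun o => (en o).1) fun o => (em o).1) fun j => (ek j).1
  have hF : Function.Bijective F := by
    constructor
    · have := fun o => (en o).2
      have := fun o => (em o).2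
      have := fun o => (ek o).2
      rintro ((a | a) | a) ((b | b) | b) h <;> simp only [F, Sum.elim_inl, Sum.elim_inr] at h <;>
        first
        | (have := Subtype.ext h; simpa using this)
        | grind
    · intro i
      rcases lt_trichotomy (l i) 0 with h | h | h
      · exact ⟨.inl (.inr (em.symm ⟨i, h⟩)), by simp [F]⟩
      · exact ⟨.inr (ek.symm ⟨i, h⟩), by simp [F]⟩
      · exact ⟨.inl (.inl (en.symm ⟨i, h⟩)), by simp [F]⟩
  let e := Equiv.ofBijective F hF
  have hcard := Fintype.card_congr e
  simp only [Fintype.card_sum, Fintype.card_option, Fintype.card_fin, hι] at hcard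
  exact ⟨_, n, m, by omega, e, by omega, by omega, fun o => (en o).2, fun o => (em o).2,
    fun j => (ek j).2⟩

/-- Two spanning families of one vector more than the dimension whose linear dependences agree up
to a rescaling are linearly equivalent up to that rescaling. -/
theorem exists_linearEquiv_of_dependence {ι W : Type*} [Fintype ι] [AddCommGroup W] [Module ℝ W]
    [FiniteDimensional ℝ W] {u w : ι → W} {l ε μ : ι → ℝ}
    (hcard : Fintype.card ι = Module.finrank ℝ W + 1) (hu : Submodule.span ℝ (range u) = ⊤)
    (hl : ∑ i, l i • u i = 0) (hl0 : l ≠ 0) (hμ : ∀ i, μ i ≠ 0) (hlε : ∀ i, l i * μ i = ε i)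
    (hw : ∀ c : ι → ℝ, ∑ i, c i • w i = 0 ↔ ∃ r : ℝ, c = r • ε) :
    ∃ L : W ≃ₗ[ℝ] W, ∀ i, L (u i) = μ i • w i := by
  classical
  set φ := Fintype.linearCombination ℝ u with hφ
  set ψ := Fintype.linearCombination ℝ (fun i => μ i • w i) with hψ
  have hφr : LinearMap.range φ = ⊤ := by rw [Fintype.range_linearCombination, hu]
  have h1 := φ.finrank_range_add_finrank_ker
  rw [hφr, finrank_top, Module.finrank_fintype_fun_eq_card, hcard] at h1
  have h2 : Module.finrank ℝ (LinearMap.ker φ) = 1 := by omega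
  have hlk : l ∈ LinearMap.ker φ := by simpa [hφ, Fintype.linearCombination_apply] using hl
  have hker : LinearMap.ker φ = LinearMap.ker ψ := by
    ext c
    have h3 : c ∈ LinearMap.ker ψ ↔ ∃ r : ℝ, c = r • l := by
      have h4 : c ∈ LinearMap.ker ψ ↔ ∑ i, (c i * μ i) • w i = 0 := by
        simp [hψ, Fintype.linearCombination_apply, smul_smul]
      rw [h4, hw]
      refine exists_congr fun r => ?_
      simp only [funext_iff, Pi.smul_apply, smul_eq_mul, ← hlε, ← mul_assoc]
      exact forall_congr' fun i => mul_left_inj' (hμ i)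
    rw [h3]
    constructor
    · intro hc
      obtain ⟨r, hr⟩ := (finrank_eq_one_iff_of_nonzero' (⟨l, hlk⟩ : LinearMap.ker φ)
        (by simpa [Subtype.ext_iff] using hl0)).1 h2 ⟨c, hc⟩
      exact ⟨r, (congrArg Subtype.val hr).symm⟩
    · rintro ⟨r, rfl⟩
      exact Submodule.smul_mem _ _ hlk
  have h5 := ψ.finrank_range_add_finrank_ker
  rw [← hker, h2, Module.finrank_fintype_fun_eq_card, hcard] at h5
  have hψr : LinearMap.range ψ = ⊤ := Submodule.eq_top_of_finrank_eq (by omega)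
  refine ⟨(φ.quotKerEquivOfSurjective (LinearMap.range_eq_top.1 hφr)).symm ≪≫ₗ
    Submodule.quotEquivOfEq _ _ hker ≪≫ₗ
    ψ.quotKerEquivOfSurjective (LinearMap.range_eq_top.1 hψr), fun i => ?_⟩
  have h6 : φ (Pi.single i 1) = u i := by simp [hφ]
  rw [← h6, LinearEquiv.trans_apply, LinearEquiv.trans_apply,
    LinearMap.quotKerEquivOfSurjective_symm_apply]
  simp [hψ]

theorem exists_linearEquiv_of_dual_dependence {ι W : Type*} [Fintype ι] [AddCommGroup W]
    [Module ℝ W] [FiniteDimensional ℝ W] {f g : ι → W →ₗ[ℝ] ℝ} {l ε μ : ι → ℝ}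
    (hcard : Fintype.card ι = Module.finrank ℝ W + 1)
    (hf : ∀ z, (∀ i, f i z = 0) → z = 0) (hg : ∀ z, (∀ i, g i z = 0) → z = 0)
    (hfl : ∀ z, ∑ i, l i * f i z = 0) (hgε : ∀ z, ∑ i, ε i * g i z = 0)
    (hε : ε ≠ 0) (hμ : ∀ i, μ i ≠ 0) (hlε : ∀ i, ε i * μ i = l i) :
    ∃ L : W ≃ₗ[ℝ] W, ∀ i z, g i (L z) = μ i * f i z := by
  classical
  set Φ : W →ₗ[ℝ] (ι → ℝ) := LinearMap.pi fun i => μ i • f i with hΦ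
  set Ψ : W →ₗ[ℝ] (ι → ℝ) := LinearMap.pi g with hΨ
  have hΦi : Function.Injective Φ := by
    refine (injective_iff_map_eq_zero Φ).2 fun z hz => hf z fun i => ?_
    simpa [hΦ, hμ] using congrFun hz i
  have hΨi : Function.Injective Ψ :=
    (injective_iff_map_eq_zero Ψ).2 fun z hz => hg z fun i => congrFun hz i
  set η : (ι → ℝ) →ₗ[ℝ] ℝ := ∑ i, ε i • LinearMap.proj i with hη
  have hη0 : η ≠ 0 := by
    obtain ⟨i, hi⟩ := Function.ne_iff.1 hε
    intro h
    apply hi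
    simpa [hη, Pi.single_apply] using LinearMap.congr_fun h (Pi.single i 1)
  have hk := Module.Dual.finrank_ker_add_one_of_ne_zero (f := η) hη0
  rw [Module.finrank_fintype_fun_eq_card, hcard] at hk
  have h1 : LinearMap.range Φ = LinearMap.ker η := by
    refine Submodule.eq_of_le_of_finrank_eq ?_ ?_
    · rintro _ ⟨z, rfl⟩
      simpa [hη, hΦ, ← mul_assoc, hlε] using hfl z
    · rw [LinearMap.finrank_range_of_inj hΦi]; omega
  have h2 : LinearMap.range Ψ = LinearMap.ker η := by
    refine Submodule.eq_of_le_of_finrank_eq ?_ ?_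
    · rintro _ ⟨z, rfl⟩
      simpa [hη, hΨ] using hgε z
    · rw [LinearMap.finrank_range_of_inj hΨi]; omega
  let L := LinearEquiv.ofInjective Φ hΦi ≪≫ₗ LinearEquiv.ofEq _ _ (h1.trans h2.symm) ≪≫ₗ
    (LinearEquiv.ofInjective Ψ hΨi).symm
  have hL (z : W) : Ψ (L z) = Φ z := by
    have : LinearEquiv.ofInjective Ψ hΨi (L z) =
      LinearEquiv.ofEq _ _ (h1.trans h2.symm) (LinearEquiv.ofInjective Φ hΦi z) := by simp [L]
    exact congrArg Subtype.val this
  exact ⟨L, fun i z => congrFun (hL z) i⟩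

theorem exists_dual_dependence {ι W : Type*} [Fintype ι] [AddCommGroup W] [Module ℝ W]
    [FiniteDimensional ℝ W] (f : ι → W →ₗ[ℝ] ℝ) (hcard : Module.finrank ℝ W < Fintype.card ι) :
    ∃ l : ι → ℝ, l ≠ 0 ∧ ∀ z, ∑ i, l i * f i z = 0 := by
  classical
  have h1 : LinearMap.range (LinearMap.pi f) < ⊤ := by
    refine lt_top_iff_ne_top.2 fun h => ?_
    have := LinearMap.finrank_range_le (LinearMap.pi f)
    rw [h, finrank_top, Module.finrank_fintype_fun_eq_card] at this
    omega
  obtain ⟨η, hη, hle⟩ := Submodule.exists_le_ker_of_lt_top _ h1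
  have h2 (x : ι → ℝ) : η x = ∑ i, η (Pi.single i 1) * x i := by
    conv_lhs => rw [pi_eq_sum_univ' x]
    simp [mul_comm]
  refine ⟨fun i => η (Pi.single i 1), fun h => hη ?_, fun z => ?_⟩
  · ext i
    simpa using congrFun h i
  · have := hle ⟨z, rfl⟩
    rw [LinearMap.mem_ker, h2] at this
    simpa using this

/-- The vertices of `simplexF n`. -/
def simplexVertex (n : ℕ) : Option (Fin n) → (Fin n → ℝ)
  | none => fun _ => -1
  | some i => Pi.single i 1

theorem simplexF_eq_convexHull_range (n : ℕ) :
    simplexF n = convexHull ℝ (range (simplexVertex n)) := by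
  rw [simplexF]
  congr 1
  ext x
  simp [simplexVertex, Option.exists, eq_comm]

/-- The homogeneous barycentric coordinates of `simplexF n`. -/
def baryCoord (n : ℕ) : Option (Fin n) → ((Fin n → ℝ) × ℝ) →ₗ[ℝ] ℝ
  | none => ((n : ℝ) + 1)⁻¹ •
      (LinearMap.snd ℝ _ _ - ∑ i, LinearMap.proj i ∘ₗ LinearMap.fst ℝ _ _)
  | some i => LinearMap.proj i ∘ₗ LinearMap.fst ℝ _ _ + ((n : ℝ) + 1)⁻¹ •
      (LinearMap.snd ℝ _ _ - ∑ i, LinearMap.proj i ∘ₗ LinearMap.fst ℝ _ _)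

theorem baryCoord_none (n : ℕ) (z : (Fin n → ℝ) × ℝ) :
    baryCoord n none z = ((n : ℝ) + 1)⁻¹ * (z.2 - ∑ i, z.1 i) := by
  simp [baryCoord]

theorem baryCoord_some (n : ℕ) (i : Fin n) (z : (Fin n → ℝ) × ℝ) :
    baryCoord n (some i) z = z.1 i + ((n : ℝ) + 1)⁻¹ * (z.2 - ∑ i, z.1 i) := by
  simp [baryCoord]

theorem sum_baryCoord (n : ℕ) (z : (Fin n → ℝ) × ℝ) : ∑ o, baryCoord n o z = z.2 := by
  simp only [Fintype.sum_option, baryCoord_none, baryCoord_some, Finset.sum_add_distrib,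
    Finset.sum_const, Finset.card_univ, Fintype.card_fin, nsmul_eq_mul]
  field_simp
  ring

theorem sum_baryCoord_smul (n : ℕ) (z : (Fin n → ℝ) × ℝ) :
    ∑ o, baryCoord n o z • simplexVertex n o = z.1 := by
  funext j
  simp [Fintype.sum_option, baryCoord_none, baryCoord_some, simplexVertex, Pi.single_apply]

theorem eq_zero_of_baryCoord {n : ℕ} {z : (Fin n → ℝ) × ℝ} (hz : ∀ o, baryCoord n o z = 0) :
    z = 0 := by
  ext1
  · rw [← sum_baryCoord_smul n z]; simp [hz]
  · rw [← sum_baryCoord n z]; simp [hz]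

theorem baryCoord_simplexVertex_nonneg (n : ℕ) (o o' : Option (Fin n)) :
    0 ≤ baryCoord n o (simplexVertex n o', 1) := by
  have h : (0 : ℝ) < (n : ℝ) + 1 := by positivity
  rcases o with _ | i <;> rcases o' with _ | j <;>
    simp [baryCoord_none, baryCoord_some, simplexVertex, Pi.single_apply]
  · positivity
  · field_simp
    linarith
  · split_ifs <;> norm_num

theorem mem_simplexF_iff {n : ℕ} {x : Fin n → ℝ} :
    x ∈ simplexF n ↔ ∀ o, 0 ≤ baryCoord n o (x, 1) := by
  rw [simplexF_eq_convexHull_range]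
  constructor
  · intro hx o
    refine convexHull_min (t := {x | 0 ≤ baryCoord n o (x, 1)}) ?_ ?_ hx
    · rintro _ ⟨o', rfl⟩
      exact baryCoord_simplexVertex_nonneg n o o'
    · rintro x hx y hy a b ha hb hab
      have : ((a • x + b • y, 1) : (Fin n → ℝ) × ℝ) = a • (x, 1) + b • (y, 1) := by
        ext <;> simp [hab]
      simp only [mem_ofPred_eq, this, map_add, map_smul, smul_eq_mul] at hx hy ⊢
      positivity
  · intro hx
    exact mem_convexHull_of_exists_fintype _ (simplexVertex n) hx (sum_baryCoord n (x, 1))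
      (fun o => mem_range_self o) (sum_baryCoord_smul n (x, 1))

/-- The homogeneous facet functionals of `prodP n m`. -/
def prodCoord (n m : ℕ) :
    Option (Fin n) ⊕ Option (Fin m) → ((Fin (n + m) → ℝ) × ℝ) →ₗ[ℝ] ℝ :=
  Sum.elim (fun o => baryCoord n o ∘ₗ (LinearMap.funLeft ℝ ℝ (Fin.castAdd m)).prodMap .id)
    fun o => baryCoord m o ∘ₗ (LinearMap.funLeft ℝ ℝ (Fin.natAdd n)).prodMap .id

theorem prodCoord_inl (n m : ℕ) (o : Option (Fin n)) (z : (Fin (n + m) → ℝ) × ℝ) :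
    prodCoord n m (.inl o) z = baryCoord n o (fun i => z.1 (Fin.castAdd m i), z.2) := rfl

theorem prodCoord_inr (n m : ℕ) (o : Option (Fin m)) (z : (Fin (n + m) → ℝ) × ℝ) :
    prodCoord n m (.inr o) z = baryCoord m o (fun i => z.1 (Fin.natAdd n i), z.2) := rfl

theorem mem_prodP_iff {n m : ℕ} {x : Fin (n + m) → ℝ} :
    x ∈ prodP n m ↔ ∀ o, 0 ≤ prodCoord n m o (x, 1) := by
  simp only [Sum.forall, prodCoord_inl, prodCoord_inr, ← mem_simplexF_iff]
  constructor
  · rintro ⟨a, ha, b, hb, rfl⟩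
    simpa using ⟨ha, hb⟩
  · rintro ⟨ha, hb⟩
    exact ⟨_, ha, _, hb, (Fin.append_castAdd_natAdd).symm⟩

theorem eq_zero_of_prodCoord {n m : ℕ} {z : (Fin (n + m) → ℝ) × ℝ}
    (hz : ∀ o, prodCoord n m o z = 0) : z = 0 := by
  have h1 := eq_zero_of_baryCoord fun o => hz (.inl o)
  have h2 := eq_zero_of_baryCoord fun o => hz (.inr o)
  ext1
  · funext i
    induction i using Fin.addCases with
    | left i => exact congrFun (congrArg Prod.fst h1) i
    | right i => exact congrFun (congrArg Prod.fst h2) i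
  · exact (congrArg Prod.snd h1 :)

theorem sum_prodCoord_inl (n m : ℕ) (z : (Fin (n + m) → ℝ) × ℝ) :
    ∑ o, prodCoord n m (.inl o) z = z.2 := sum_baryCoord n _

theorem sum_prodCoord_inr (n m : ℕ) (z : (Fin (n + m) → ℝ) × ℝ) :
    ∑ o, prodCoord n m (.inr o) z = z.2 := sum_baryCoord m _

theorem prodCoord_snd_pos {n m : ℕ} {z : (Fin (n + m) → ℝ) × ℝ}
    (hz : ∀ o, 0 ≤ prodCoord n m o z) (hz0 : z ≠ 0) : 0 < z.2 := by
  have h1 : 0 ≤ z.2 := by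
    rw [← sum_prodCoord_inl]
    exact Finset.sum_nonneg fun o _ => hz _
  refine h1.lt_of_ne fun h => hz0 (eq_zero_of_prodCoord ?_)
  have h2 := sum_prodCoord_inl n m z
  have h3 := sum_prodCoord_inr n m z
  rw [← h, Finset.sum_eq_zero_iff_of_nonneg fun o _ => hz _] at h2 h3
  rintro (o | o)
  · exact h2 o (Finset.mem_univ _)
  · exact h3 o (Finset.mem_univ _)

/-- Projection of the homogenization of a `k`-fold pyramid onto that of its base. -/
def pyrBaseMap (p k : ℕ) : ((Fin (p + k) → ℝ) × ℝ) →ₗ[ℝ] ((Fin p → ℝ) × ℝ) :=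
  (LinearMap.funLeft ℝ ℝ (Fin.castAdd k) ∘ₗ LinearMap.fst ℝ _ _).prod
    (LinearMap.snd ℝ _ _ - ∑ j, LinearMap.proj (Fin.natAdd p j) ∘ₗ LinearMap.fst ℝ _ _)

theorem pyrBaseMap_apply (p k : ℕ) (z : (Fin (p + k) → ℝ) × ℝ) :
    pyrBaseMap p k z = (fun i => z.1 (Fin.castAdd k i), z.2 - ∑ j, z.1 (Fin.natAdd p j)) := by
  ext
  · rfl
  · simp [pyrBaseMap]

/-- The homogeneous facet functionals of a `k`-fold pyramid, from those of its base. -/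
def pyrCoord {p : ℕ} {ι : Type*} (k : ℕ) (h : ι → ((Fin p → ℝ) × ℝ) →ₗ[ℝ] ℝ) :
    ι ⊕ Fin k → ((Fin (p + k) → ℝ) × ℝ) →ₗ[ℝ] ℝ :=
  Sum.elim (fun i => h i ∘ₗ pyrBaseMap p k)
    fun j => LinearMap.proj (Fin.natAdd p j) ∘ₗ LinearMap.fst ℝ _ _

theorem pyrCoord_inl {p : ℕ} {ι : Type*} (k : ℕ) (h : ι → ((Fin p → ℝ) × ℝ) →ₗ[ℝ] ℝ) (i : ι)
    (z : (Fin (p + k) → ℝ) × ℝ) : pyrCoord k h (.inl i) z = h i (pyrBaseMap p k z) := rfl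

theorem pyrCoord_inr {p : ℕ} {ι : Type*} (k : ℕ) (h : ι → ((Fin p → ℝ) × ℝ) →ₗ[ℝ] ℝ) (j : Fin k)
    (z : (Fin (p + k) → ℝ) × ℝ) : pyrCoord k h (.inr j) z = z.1 (Fin.natAdd p j) := rfl

theorem pyrBaseMap_injOn {p k : ℕ} {z : (Fin (p + k) → ℝ) × ℝ} (h : pyrBaseMap p k z = 0)
    (hz : ∀ j, z.1 (Fin.natAdd p j) = 0) : z = 0 := by
  rw [pyrBaseMap_apply] at h
  ext1
  · funext i
    induction i using Fin.addCases with
    | left i => exact congrFun (congrArg Prod.fst h) i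
    | right i => exact hz i
  · simpa [hz] using congrArg Prod.snd h

theorem eq_zero_of_pyrCoord {p k : ℕ} {ι : Type*} {h : ι → ((Fin p → ℝ) × ℝ) →ₗ[ℝ] ℝ}
    (hh : ∀ z, (∀ i, h i z = 0) → z = 0) {z : (Fin (p + k) → ℝ) × ℝ}
    (hz : ∀ i, pyrCoord k h i z = 0) : z = 0 :=
  pyrBaseMap_injOn (hh _ fun i => hz (.inl i)) fun j => hz (.inr j)

theorem pyrCoord_snd_pos {p k : ℕ} {ι : Type*} {h : ι → ((Fin p → ℝ) × ℝ) →ₗ[ℝ] ℝ}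
    (hh : ∀ z, (∀ i, 0 ≤ h i z) → z ≠ 0 → 0 < z.2) {z : (Fin (p + k) → ℝ) × ℝ}
    (hz : ∀ i, 0 ≤ pyrCoord k h i z) (hz0 : z ≠ 0) : 0 < z.2 := by
  have h1 : z.2 = (pyrBaseMap p k z).2 + ∑ j, z.1 (Fin.natAdd p j) := by
    simp [pyrBaseMap_apply]
  have h2 : 0 ≤ ∑ j, z.1 (Fin.natAdd p j) := Finset.sum_nonneg fun j _ => hz (.inr j)
  by_cases h3 : pyrBaseMap p k z = 0
  · rw [h1, h3]
    refine lt_of_le_of_ne (by simpa using h2) fun h4 => hz0 (pyrBaseMap_injOn h3 fun j => ?_)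
    rw [Prod.snd_zero, zero_add] at h4
    exact (Finset.sum_eq_zero_iff_of_nonneg fun j _ => hz (.inr j)).1 h4.symm j (Finset.mem_univ _)
  · have := hh _ (fun i => hz (.inl i)) h3
    linarith

theorem mem_pyrK_iff {p k : ℕ} {ι : Type*} {X : Set (Fin p → ℝ)}
    {h : ι → ((Fin p → ℝ) × ℝ) →ₗ[ℝ] ℝ} (hX : ∀ x, x ∈ X ↔ ∀ i, 0 ≤ h i (x, 1))
    (hne : X.Nonempty) (hh : ∀ z, (∀ i, 0 ≤ h i z) → z ≠ 0 → 0 < z.2) {y : Fin (p + k) → ℝ} :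
    y ∈ pyrK k X ↔ ∀ i, 0 ≤ pyrCoord k h i (y, 1) := by
  constructor
  · intro hy i
    refine convexHull_min (t := {y | 0 ≤ pyrCoord k h i (y, 1)}) ?_ ?_ hy
    · rintro _ (⟨x, hx, rfl⟩ | ⟨j, rfl⟩)
      · rcases i with i | i
        · simpa [pyrCoord_inl, pyrBaseMap_apply] using (hX x).1 hx i
        · simp [pyrCoord_inr]
      · rcases i with i | i
        · have : (fun i : Fin p => (0 : ℝ)) = 0 := rfl
          have h0 : ((0, 0) : (Fin p → ℝ) × ℝ) = 0 := rfl
          simp [pyrCoord_inl, pyrBaseMap_apply, this, h0]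
        · simp only [mem_ofPred_eq, pyrCoord_inr, Fin.append_right, Pi.single_apply]
          split_ifs <;> norm_num
    · rintro x hx y hy a b ha hb hab
      have : ((a • x + b • y, 1) : (Fin (p + k) → ℝ) × ℝ) = a • (x, 1) + b • (y, 1) := by
        ext <;> simp [hab]
      simp only [mem_ofPred_eq, this, map_add, map_smul, smul_eq_mul] at hx hy ⊢
      positivity
  · intro hy
    set z : (Fin p → ℝ) × ℝ := pyrBaseMap p k (y, 1) with hz
    have hz1 : z.1 = fun i => y (Fin.castAdd k i) := by simp [hz, pyrBaseMap_apply]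
    have hz2 : z.2 = 1 - ∑ j, y (Fin.natAdd p j) := by simp [hz, pyrBaseMap_apply]
    obtain ⟨x, hx, hx1, hx2⟩ : ∃ x ∈ X, 0 ≤ z.2 ∧ z.2 • x = z.1 := by
      by_cases h0 : z = 0
      · obtain ⟨x, hx⟩ := hne
        exact ⟨x, hx, by simp [h0]⟩
      · have h1 := hh z (fun i => hy (.inl i)) h0
        refine ⟨z.2⁻¹ • z.1, (hX _).2 fun i => ?_, h1.le, smul_inv_smul₀ h1.ne' _⟩
        have : ((z.2⁻¹ • z.1, 1) : (Fin p → ℝ) × ℝ) = z.2⁻¹ • z := by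
          ext
          · simp
          · simp [h1.ne']
        rw [this, map_smul, smul_eq_mul]
        exact mul_nonneg (inv_nonneg.2 h1.le) (hy (.inl i))
    refine mem_convexHull_of_exists_fintype
      (fun o : Option (Fin k) => o.elim z.2 fun j => y (Fin.natAdd p j))
      (fun o : Option (Fin k) => o.elim (Fin.append x 0)
        fun j => Fin.append 0 (Pi.single j 1)) ?_ ?_ ?_ ?_
    · rintro (_ | j)
      · exact hx1
      · exact hy (.inr j)
    · simp [Fintype.sum_option, hz2]
    · rintro (_ | j)
      · exact .inl ⟨x, hx, rfl⟩
      · exact .inr ⟨j, rfl⟩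
    · funext i
      induction i using Fin.addCases with
      | left i => simpa [Fintype.sum_option, hz1] using congrFun hx2 i
      | right i => simp [Fintype.sum_option, Pi.single_apply]

/-- The vertices of `pyrK k (sumP n m)`. -/
def pyrSumVertex (n m k : ℕ) :
    (Option (Fin n) ⊕ Option (Fin m)) ⊕ Fin k → (Fin (n + m + k) → ℝ) :=
  Sum.elim
    (Sum.elim (fun o => Fin.append (Fin.append (simplexVertex n o) 0) 0)
      fun o => Fin.append (Fin.append 0 (simplexVertex m o)) 0)
    fun j => Fin.append 0 (Pi.single j 1)

theorem sumP_eq_convexHull_range (n m : ℕ) :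
    sumP n m = convexHull ℝ (range (Sum.elim (fun o => Fin.append (simplexVertex n o) 0)
      fun o => Fin.append 0 (simplexVertex m o))) := by
  have h1 : IsLinearMap ℝ fun a : Fin n → ℝ => Fin.append a (0 : Fin m → ℝ) := by
    constructor <;> intros <;> funext i <;> refine Fin.addCases (fun i => ?_) (fun i => ?_) i <;>
      simp
  have h2 : IsLinearMap ℝ fun b : Fin m → ℝ => Fin.append (0 : Fin n → ℝ) b := by
    constructor <;> intros <;> funext i <;> refine Fin.addCases (fun i => ?_) (fun i => ?_) i <;>
      simp
  rw [sumP, simplexF_eq_convexHull_range, simplexF_eq_convexHull_range, h1.image_convexHull,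
    h2.image_convexHull, convexHull_convexHull_union_left, convexHull_convexHull_union_right,
    Sum.elim_range, ← range_comp, ← range_comp]
  rfl

theorem pyrK_sumP_eq_convexHull_range (n m k : ℕ) :
    pyrK k (sumP n m) = convexHull ℝ (range (pyrSumVertex n m k)) := by
  have h1 : IsLinearMap ℝ fun a : Fin (n + m) → ℝ => Fin.append a (0 : Fin k → ℝ) := by
    constructor <;> intros <;> funext i <;> refine Fin.addCases (fun i => ?_) (fun i => ?_) i <;>
      simp
  rw [pyrK, sumP_eq_convexHull_range, h1.image_convexHull, convexHull_convexHull_union_left,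
    pyrSumVertex, Sum.elim_range, Sum.elim_range, Sum.elim_range, image_union, ← range_comp,
    ← range_comp]
  rfl

/-- The coefficients of the affine dependence between the vertices of `pyrK k (sumP n m)`. -/
def pyrSumDependence (n m k : ℕ) : (Option (Fin n) ⊕ Option (Fin m)) ⊕ Fin k → ℝ :=
  Sum.elim (Sum.elim (fun _ => ((n : ℝ) + 1)⁻¹) fun _ => -((m : ℝ) + 1)⁻¹) fun _ => 0

theorem sum_smul_pyrSumVertex_eq_zero_iff {n m k : ℕ}
    (c : (Option (Fin n) ⊕ Option (Fin m)) ⊕ Fin k → ℝ) :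
    ∑ i, c i • ((pyrSumVertex n m k i, 1) : (Fin (n + m + k) → ℝ) × ℝ) = 0 ↔
      ∃ r : ℝ, c = r • pyrSumDependence n m k := by
  have hn : (0 : ℝ) < (n : ℝ) + 1 := by positivity
  have hm : (0 : ℝ) < (m : ℝ) + 1 := by positivity
  simp only [Prod.ext_iff, funext_iff, Prod.fst_sum, Prod.snd_sum, Prod.smul_mk, smul_eq_mul,
    mul_one]
  simp only [Fintype.sum_sum_type, Fintype.sum_option, pyrSumVertex, Sum.elim_inl, Sum.elim_inr,
    Prod.fst_zero, Prod.snd_zero]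
  constructor
  · rintro ⟨h1, h2⟩
    have ha (i : Fin n) : c (.inl (.inl (some i))) = c (.inl (.inl none)) := by
      have := h1 (Fin.castAdd k (Fin.castAdd m i))
      simp [simplexVertex, Pi.single_apply] at this
      linarith
    have hb (i : Fin m) : c (.inl (.inr (some i))) = c (.inl (.inr none)) := by
      have := h1 (Fin.castAdd k (Fin.natAdd n i))
      simp [simplexVertex, Pi.single_apply] at this
      linarith
    have hc (i : Fin k) : c (.inr i) = 0 := by
      have := h1 (Fin.natAdd (n + m) i)
      simpa [simplexVertex, Pi.single_apply] using this
    simp [ha, hb, hc] at h2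
    refine ⟨((n : ℝ) + 1) * c (.inl (.inl none)), ?_⟩
    rintro (((_ | i) | (_ | i)) | i) <;>
      simp only [ha, hb, hc, Pi.smul_apply, smul_eq_mul, pyrSumDependence, Sum.elim_inl,
        Sum.elim_inr, mul_zero] <;> field_simp <;> linarith
  · rintro ⟨r, hr⟩
    obtain rfl : c = r • pyrSumDependence n m k := funext hr
    constructor
    · intro i
      induction i using Fin.addCases with
      | left i =>
        induction i using Fin.addCases with
        | left i => simp [simplexVertex, pyrSumDependence, Pi.single_apply]
        | right i => simp [simplexVertex, pyrSumDependence, Pi.single_apply]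
      | right i => simp [simplexVertex, pyrSumDependence]
    · simp [pyrSumDependence]
      field_simp
      ring

theorem isVertexOf_iff_exposed {N : ℕ} {v : Fin N → ℝ} {P : Set (Fin N → ℝ)} :
    IsVertexOf v P ↔
      v ∈ P ∧ ∃ f : (Fin N → ℝ) →ₗ[ℝ] ℝ, ∀ x ∈ P, f x ≤ f v ∧ (f x = f v → x = v) := by
  constructor
  · rintro ⟨c, b, hle, h⟩
    have hv : v ∈ P ∧ ∑ i, c i * v i = b := by
      have : v ∈ ({v} : Set (Fin N → ℝ)) := rfl
      rwa [h] at this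
    refine ⟨hv.1, ∑ i, c i • LinearMap.proj i, fun x hx => ?_⟩
    simp only [LinearMap.coe_sum, Finset.sum_apply, LinearMap.smul_apply, LinearMap.proj_apply,
      smul_eq_mul, hv.2]
    refine ⟨hle x hx, fun hxb => ?_⟩
    have : x ∈ ({v} : Set (Fin N → ℝ)) := by rw [h]; exact ⟨hx, hxb⟩
    exact this
  · rintro ⟨hv, f, hf⟩
    refine ⟨fun i => f (Pi.single i 1), f v, fun x hx => ?_, ?_⟩
    · rw [← linearMap_apply_eq_sum_single]
      exact (hf x hx).1
    · ext x
      rw [mem_singleton_iff, mem_ofPred_eq, ← linearMap_apply_eq_sum_single]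
      constructor
      · rintro rfl
        exact ⟨hv, rfl⟩
      · exact fun hx => (hf x hx.1).2 hx.2

theorem IsVertexOf.notMem_convexHull {N : ℕ} {v : Fin N → ℝ} {P T : Set (Fin N → ℝ)}
    (hv : IsVertexOf v P) (hT : T ⊆ P) (hvT : v ∉ T) : v ∉ convexHull ℝ T := by
  obtain ⟨-, f, hf⟩ := isVertexOf_iff_exposed.1 hv
  intro h
  have : convexHull ℝ T ⊆ {x | f x < f v} := by
    refine convexHull_min (fun x hx => ?_) (convex_halfSpace_lt f.isLinear _)
    refine (hf x (hT hx)).1.lt_of_ne fun h => hvT ?_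
    rwa [← (hf x (hT hx)).2 h]
  exact lt_irrefl (f v) (this h)

theorem isVertexOf_convexHull_insert {N : ℕ} {v : Fin N → ℝ} {T : Finset (Fin N → ℝ)}
    (hv : v ∉ convexHull ℝ (T : Set (Fin N → ℝ))) :
    IsVertexOf v (convexHull ℝ (insert v (T : Set (Fin N → ℝ)))) := by
  obtain ⟨f, u, hlt, hu⟩ := geometric_hahn_banach_closed_point
    (convex_convexHull ℝ (T : Set (Fin N → ℝ))) (T.finite_toSet.isCompact_convexHull ℝ).isClosed hv
  refine isVertexOf_iff_exposed.2
    ⟨subset_convexHull _ _ (mem_insert _ _), (f : (Fin N → ℝ) →ₗ[ℝ] ℝ), fun x hx => ?_⟩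
  rcases T.eq_empty_or_nonempty with rfl | hT
  · simp only [Finset.coe_empty, insert_empty_eq, convexHull_singleton, mem_singleton_iff] at hx
    simp [hx]
  rw [convexHull_insert (by simpa using hT)] at hx
  obtain ⟨w, hw, y, hy, hxw⟩ := mem_convexJoin.1 hx
  obtain rfl := mem_singleton_iff.1 hw
  rw [segment_eq_image] at hxw
  obtain ⟨b, ⟨hb, -⟩, rfl⟩ := hxw
  have h1 := (hlt y hy).trans hu
  simp only [ContinuousLinearMap.coe_coe, map_add, map_smul, smul_eq_mul]
  constructor
  · nlinarith
  · intro h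
    have : b = 0 := by
      by_contra hb0
      have := mul_lt_mul_of_pos_left h1 (hb.lt_of_ne' hb0)
      linarith
    simp [this]

/-- A polytope is the convex hull of its vertices, which are finitely many. -/
theorem IsPolytope.exists_vertices {N : ℕ} {P : Set (Fin N → ℝ)} (hP : IsPolytope P) :
    ∃ S : Finset (Fin N → ℝ), (S : Set (Fin N → ℝ)) = vertexSet P ∧
      P = convexHull ℝ (S : Set (Fin N → ℝ)) := by
  classical
  obtain ⟨S, hS, hmin⟩ := (wellFounded_lt (α := Finset (Fin N → ℝ))).has_min
    {S | P = convexHull ℝ (S : Set (Fin N → ℝ))} hP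
  refine ⟨S, ?_, hS⟩
  ext v
  constructor
  · intro hv
    have hins : insert v ((S.erase v : Finset _) : Set (Fin N → ℝ)) = S := by
      rw [← Finset.coe_insert, Finset.insert_erase hv]
    have hv' : v ∉ convexHull ℝ ((S.erase v : Finset _) : Set (Fin N → ℝ)) := by
      intro h
      refine hmin (S.erase v) ?_ (Finset.erase_ssubset hv)
      refine (show P = _ from hS).trans (Subset.antisymm ?_ (convexHull_mono ?_))
      · refine convexHull_min ?_ (convex_convexHull _ _)
        rw [← hins]
        exact insert_subset h (subset_convexHull _ _)
      · exact_mod_cast Finset.erase_subset v S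
    have := isVertexOf_convexHull_insert hv'
    rwa [hins, ← show P = _ from hS] at this
  · intro hv
    by_contra hvS
    refine IsVertexOf.notMem_convexHull hv (T := S) ?_ hvS ?_
    · rw [show P = _ from hS]
      exact subset_convexHull _ _
    · rw [← show P = _ from hS]
      exact (isVertexOf_iff_exposed.1 hv).1

theorem affineSpan_eq_top_of_pdim {d : ℕ} {P : Set (Fin d → ℝ)} (hd : pdim P = d) :
    P.Nonempty ∧ affineSpan ℝ P = ⊤ := by
  classical
  unfold pdim at hd
  split_ifs at hd with h
  refine ⟨h, ?_⟩
  have h1 : Module.finrank ℝ (affineSpan ℝ P).direction = d := by exact_mod_cast hd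
  rw [← AffineSubspace.direction_eq_top_iff_of_nonempty ((affineSpan_nonempty ℝ).2 h)]
  exact Submodule.eq_top_of_finrank_eq (by simpa using h1)

theorem span_homogenization_eq_top {V ι : Type*} [AddCommGroup V] [Module ℝ V] {v : ι → V}
    (h : affineSpan ℝ (range v) = ⊤) :
    Submodule.span ℝ (range fun i => ((v i, 1) : V × ℝ)) = ⊤ := by
  set U := Submodule.span ℝ (range fun i => ((v i, 1) : V × ℝ)) with hU
  have hne : (range v).Nonempty := by
    rw [← affineSpan_nonempty ℝ, h]
    exact ⟨0, trivial⟩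
  obtain ⟨_, ⟨i₀, rfl⟩⟩ := hne
  have hmem (i : ι) : ((v i, 1) : V × ℝ) ∈ U := Submodule.subset_span ⟨i, rfl⟩
  have h1 (x : V) : ((x, 0) : V × ℝ) ∈ U := by
    have hx : x ∈ vectorSpan ℝ (range v) := by
      rw [← direction_affineSpan, h, AffineSubspace.direction_top]
      trivial
    have : vectorSpan ℝ (range v) ≤ U.comap (LinearMap.inl ℝ V ℝ) := by
      rw [vectorSpan, Submodule.span_le]
      rintro _ ⟨_, ⟨i, rfl⟩, _, ⟨j, rfl⟩, rfl⟩
      simpa using U.sub_mem (hmem i) (hmem j)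
    exact this hx
  refine eq_top_iff.2 fun z _ => ?_
  have : z = (z.1 - z.2 • v i₀, 0) + z.2 • (v i₀, 1) := by ext <;> simp
  rw [this]
  exact U.add_mem (h1 _) (U.smul_mem _ (hmem i₀))

/-- An affine dependence between points in convex position has at least two positive
coefficients. -/
theorem exists_two_pos_of_affine_dependence {V ι : Type*} [Fintype ι] [AddCommGroup V]
    [Module ℝ V] {v : ι → V} (hv : ∀ i, v i ∉ convexHull ℝ (v '' {i}ᶜ)) {l : ι → ℝ} (hl0 : l ≠ 0)
    (hsum : ∑ i, l i = 0) (hl : ∑ i, l i • v i = 0) : ∃ i j, i ≠ j ∧ 0 < l i ∧ 0 < l j := by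
  classical
  obtain ⟨i, hi⟩ : ∃ i, 0 < l i := by
    by_contra! h
    exact hl0 (funext fun i => (Finset.sum_eq_zero_iff_of_nonpos fun i _ => h i).1 hsum i
      (Finset.mem_univ i))
  by_contra! h
  have hle (j : ι) (hj : j ∈ ({i}ᶜ : Finset ι)) : 0 ≤ -(l j / l i) := by
    have hji : j ≠ i := by simpa using hj
    have : l j ≤ 0 := h i j hji.symm hi
    rw [← neg_div]
    exact div_nonneg (by linarith) hi.le
  rw [Fintype.sum_eq_add_sum_compl i] at hsum hl
  have h1 : ∑ j ∈ ({i}ᶜ : Finset ι), -(l j / l i) = 1 := by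
    rw [Finset.sum_neg_distrib, ← Finset.sum_div]
    field_simp
    linarith
  refine hv i ?_
  have h2 : ∑ j ∈ ({i}ᶜ : Finset ι), (-(l j / l i)) • v j = v i := by
    have h3 : ∑ j ∈ ({i}ᶜ : Finset ι), (-(l j / l i)) • v j =
        (-(l i)⁻¹) • ∑ j ∈ ({i}ᶜ : Finset ι), l j • v j := by
      rw [Finset.smul_sum]
      refine Finset.sum_congr rfl fun j _ => ?_
      rw [smul_smul, div_eq_inv_mul, neg_mul]
    rw [h3, ← neg_eq_of_add_eq_zero_right hl, smul_neg, neg_smul, neg_neg, smul_smul,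
      inv_mul_cancel₀ hi.ne', one_smul]
  rw [← h2]
  refine (convex_convexHull ℝ _).sum_mem hle h1 fun j hj => subset_convexHull _ _ ⟨j, ?_, rfl⟩
  simpa using hj

theorem exists_projEquiv_of_vertexCount {d : ℕ} {P : Set (Fin d → ℝ)} (hP : IsPolytope P)
    (hd : pdim P = d) (hcount : vertexCount P = d + 2) :
    ∃ (k n m : ℕ) (h : n + m + k = d), 1 ≤ n ∧ 1 ≤ m ∧
      ProjEquiv P (castSet h (pyrK k (sumP n m))) := by
  classical
  obtain ⟨S, hSv, hS⟩ := hP.exists_vertices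
  have hScard : Fintype.card S = d + 2 := by
    rw [Fintype.card_coe, ← hcount, vertexCount, ← hSv, ncard_coe_finset]
  let v : S → (Fin d → ℝ) := Subtype.val
  have hrange : range v = S := by simp [v]
  have hPv : P = convexHull ℝ (range v) := by rw [hrange, hS]
  have hv (i : S) : v i ∉ convexHull ℝ (v '' {i}ᶜ) := by
    have hi : IsVertexOf (v i) P := by
      have : v i ∈ vertexSet P := by rw [← hSv]; exact i.2
      exact this
    refine hi.notMem_convexHull ?_ ?_
    · rw [hPv]
      exact (image_subset_range _ _).trans (subset_convexHull _ _)
    · rintro ⟨j, hj, hji⟩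
      exact hj (Subtype.ext hji)
  have hspan : affineSpan ℝ (range v) = ⊤ := by
    rw [← affineSpan_convexHull, ← hPv]
    exact (affineSpan_eq_top_of_pdim hd).2
  set u : S → (Fin d → ℝ) × ℝ := fun i => (v i, 1) with hu
  have hspan' : Submodule.span ℝ (range u) = ⊤ := span_homogenization_eq_top hspan
  have hfin : Module.finrank ℝ ((Fin d → ℝ) × ℝ) = d + 1 := by simp
  obtain ⟨l, hl, i, hi⟩ : ∃ l : S → ℝ, ∑ i, l i • u i = 0 ∧ ∃ i, l i ≠ 0 := by
    refine Fintype.not_linearIndependent_iff.1 fun h => ?_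
    have := h.fintype_card_le_finrank
    omega
  have hl0 : l ≠ 0 := fun h => hi (congrFun h i)
  have hl1 : ∑ i, l i • v i = 0 := by
    simpa [hu, Prod.fst_sum] using congrArg Prod.fst hl
  have hl2 : ∑ i, l i = 0 := by
    simpa [hu, Prod.snd_sum] using congrArg Prod.snd hl
  obtain ⟨k, n, m, rfl, e, hn, hm, hpos, hneg, hzero⟩ := exists_equiv_of_signs hScard l
    (exists_two_pos_of_affine_dependence hv hl0 hl2 hl1) (by
      simpa using exists_two_pos_of_affine_dependence hv (l := -l) (neg_ne_zero.2 hl0)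
        (by simpa using hl2) (by simpa using hl1))
  refine ⟨k, n, m, rfl, hn, hm, ?_⟩
  have hcast : castSet rfl (pyrK k (sumP n m)) = pyrK k (sumP n m) := by simp [castSet]
  rw [hcast, pyrK_sumP_eq_convexHull_range, hPv, ← e.surjective.range_comp v]
  have hex (i : (Option (Fin n) ⊕ Option (Fin m)) ⊕ Fin k) :
      ∃ μ : ℝ, 0 < μ ∧ l (e i) * μ = pyrSumDependence n m k i := by
    have hn' : (0 : ℝ) < ((n : ℝ) + 1)⁻¹ := by positivity
    have hm' : (0 : ℝ) < ((m : ℝ) + 1)⁻¹ := by positivity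
    rcases i with (i | i) | i
    · exact ⟨((n : ℝ) + 1)⁻¹ / l (e (.inl (.inl i))), div_pos hn' (hpos i),
        mul_div_cancel₀ _ (hpos i).ne'⟩
    · exact ⟨-((m : ℝ) + 1)⁻¹ / l (e (.inl (.inr i))),
        div_pos_of_neg_of_neg (by simpa using hm') (hneg i), mul_div_cancel₀ _ (hneg i).ne⟩
    · exact ⟨1, one_pos, by simp [hzero, pyrSumDependence]⟩
  choose μ hμ hlμ using hex
  obtain ⟨L, hL⟩ := exists_linearEquiv_of_dependence (u := u ∘ e) (l := l ∘ e)
    (w := fun i => ((pyrSumVertex n m k i, 1) : (Fin (n + m + k) → ℝ) × ℝ))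
    (by rw [Fintype.card_congr e, hScard, hfin]) (by rwa [e.surjective.range_comp])
    ((e.sum_comp fun i => l i • u i).trans hl)
    (fun h => hi (by simpa using congrFun h (e.symm i))) (fun i => (hμ i).ne') hlμ
    sum_smul_pyrSumVertex_eq_zero_iff
  exact projEquiv_convexHull_range L hμ hL

theorem isFaceOf_iff {N : ℕ} {F P : Set (Fin N → ℝ)} :
    IsFaceOf F P ↔ ∃ f : ((Fin N → ℝ) × ℝ) →ₗ[ℝ] ℝ,
      (∀ x ∈ P, 0 ≤ f (x, 1)) ∧ F = {x ∈ P | f (x, 1) = 0} := by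
  constructor
  · rintro ⟨c, b, hle, rfl⟩
    have h (x : Fin N → ℝ) : (b • LinearMap.snd ℝ (Fin N → ℝ) ℝ -
        (∑ i, c i • LinearMap.proj i : (Fin N → ℝ) →ₗ[ℝ] ℝ) ∘ₗ LinearMap.fst ℝ (Fin N → ℝ) ℝ :
          ((Fin N → ℝ) × ℝ) →ₗ[ℝ] ℝ) (x, 1) = b - ∑ i, c i * x i := by simp
    refine ⟨_, fun x hx => (sub_nonneg.2 (hle x hx)).trans_eq (h x).symm, ?_⟩
    ext x
    simp only [mem_ofPred_eq, h, sub_eq_zero]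
    exact and_congr_right fun _ => eq_comm
  · rintro ⟨f, hf, rfl⟩
    have h (x : Fin N → ℝ) : f (x, 1) = f (0, 1) - ∑ i, -f (Pi.single i 1, 0) * x i := by
      have h1 : ((x, 1) : (Fin N → ℝ) × ℝ) = (0, 1) + (x, 0) := by simp
      have h2 := linearMap_apply_eq_sum_single (f ∘ₗ LinearMap.inl ℝ (Fin N → ℝ) ℝ) x
      simp only [LinearMap.comp_apply, LinearMap.inl_apply] at h2
      rw [h1, map_add, h2]
      simp only [neg_mul, Finset.sum_neg_distrib, sub_neg_eq_add]
    refine ⟨fun i => -f (Pi.single i 1, 0), f (0, 1), fun x hx => ?_, ?_⟩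
    · have := hf x hx
      rw [h] at this
      linarith
    · ext x
      rw [mem_ofPred_eq, mem_ofPred_eq, h x, sub_eq_zero]
      exact and_congr_right fun _ => eq_comm

theorem apply_line_one {V : Type*} [AddCommGroup V] [Module ℝ V] (f : (V × ℝ) →ₗ[ℝ] ℝ)
    (p x : V) (t : ℝ) : f (p + t • (x - p), 1) = (1 - t) * f (p, 1) + t * f (x, 1) := by
  have : ((p + t • (x - p), 1) : V × ℝ) = (1 - t) • (p, 1) + t • (x, 1) := by
    ext
    · simp only [Prod.smul_mk, Prod.mk_add_mk]
      module
    · simp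
  rw [this, map_add, map_smul, map_smul, smul_eq_mul, smul_eq_mul]

theorem apply_one_eq_zero_of_mem_affineSpan {V : Type*} [AddCommGroup V] [Module ℝ V]
    {f : (V × ℝ) →ₗ[ℝ] ℝ} {F : Set V} (hf : ∀ y ∈ F, f (y, 1) = 0) {x : V}
    (hx : x ∈ affineSpan ℝ F) : f (x, 1) = 0 := by
  refine affineSpan_induction hx hf fun c u v w hu hv hw => ?_
  have : ((c • (u -ᵥ v) +ᵥ w, 1) : V × ℝ) = c • ((u, 1) - (v, 1)) + (w, 1) := by simp
  rw [this, map_add, map_smul, map_sub, hu, hv, hw]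
  simp

theorem apply_one_eq_zero_of_mem_interior {N : ℕ} {P : Set (Fin N → ℝ)} {p : Fin N → ℝ}
    (hp : p ∈ interior P) {f : ((Fin N → ℝ) × ℝ) →ₗ[ℝ] ℝ} (hf : ∀ x ∈ P, 0 ≤ f (x, 1))
    (hfp : f (p, 1) = 0) (x : Fin N → ℝ) : f (x, 1) = 0 := by
  have hcont : Continuous fun t : ℝ => p + t • (x - p) := by fun_prop
  have hnhds : ∀ᶠ t in nhds (0 : ℝ), p + t • (x - p) ∈ P :=
    hcont.continuousAt.eventually_mem (by simpa using mem_interior_iff_mem_nhds.1 hp)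
  obtain ⟨ε, hε, h⟩ := Metric.eventually_nhds_iff.1 hnhds
  have h1 := hf _ (h (y := ε / 2) (by simp [abs_of_pos hε, hε]))
  have h2 := hf _ (h (y := -(ε / 2)) (by simp [abs_of_pos hε, hε]))
  rw [apply_line_one, hfp, mul_zero, zero_add] at h1 h2
  nlinarith

theorem exists_pos_of_mem_interior_convexHull {N : ℕ} {S : Set (Fin N → ℝ)} {p : Fin N → ℝ}
    (hp : p ∈ interior (convexHull ℝ S)) {w : (Fin N → ℝ) →ₗ[ℝ] ℝ} (hw : w ≠ 0) :
    ∃ s ∈ S, 0 < w (s - p) := by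
  by_contra! h
  have hval (x : Fin N → ℝ) : (w p • LinearMap.snd ℝ (Fin N → ℝ) ℝ -
      w ∘ₗ LinearMap.fst ℝ (Fin N → ℝ) ℝ) (x, 1) = -w (x - p) := by simp
  have hle : convexHull ℝ S ⊆ {x | w x ≤ w p} := by
    refine convexHull_min (fun s hs => ?_) (convex_halfSpace_le w.isLinear _)
    have := h s hs
    rw [map_sub] at this
    exact sub_nonpos.1 this
  have hzero := apply_one_eq_zero_of_mem_interior hp
    (f := w p • LinearMap.snd ℝ (Fin N → ℝ) ℝ - w ∘ₗ LinearMap.fst ℝ (Fin N → ℝ) ℝ)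
    (fun x hx => by
      have hx : w x ≤ w p := hle hx
      rw [hval, map_sub]
      linarith) (by simp)
  refine hw (LinearMap.ext fun x => ?_)
  have := hzero (x + p)
  rw [hval] at this
  simpa using this

theorem pdim_of_nonempty {N : ℕ} {P : Set (Fin N → ℝ)} (h : P.Nonempty) :
    pdim P = Module.finrank ℝ (affineSpan ℝ P).direction := by
  unfold pdim
  exact if_pos h

/-- A functional bounding a finite set from above by `1`, and strictly exceeding `1` at `v`, can be
tilted until it is tight on a spanning subset. -/
theorem exists_tight_span_eq_top {V : Type*} [AddCommGroup V] [Module ℝ V]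
    {S : Finset V} (hS : ∀ w : V →ₗ[ℝ] ℝ, w ≠ 0 → ∃ s ∈ S, 0 < w s) {v : V}
    {c₀ : V →ₗ[ℝ] ℝ} (hc₀ : ∀ s ∈ S, c₀ s ≤ 1) (hv : 1 < c₀ v) :
    ∃ c : V →ₗ[ℝ] ℝ, (∀ s ∈ S, c s ≤ 1) ∧ 1 < c v ∧
      Submodule.span ℝ {s | s ∈ S ∧ c s = 1} = ⊤ := by
  classical
  obtain ⟨c, ⟨hcS, hcv⟩, hmin⟩ := (measure fun c : V →ₗ[ℝ] ℝ => {s ∈ S | c s < 1}.card).wf.has_min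
    {c | (∀ s ∈ S, c s ≤ 1) ∧ 1 < c v} ⟨c₀, hc₀, hv⟩
  refine ⟨c, hcS, hcv, ?_⟩
  by_contra hspan
  obtain ⟨w, hw, hwv, hwT⟩ : ∃ w : V →ₗ[ℝ] ℝ, w ≠ 0 ∧ 0 ≤ w v ∧ ∀ s ∈ S, c s = 1 → w s = 0 := by
    obtain ⟨w, hw, hwT⟩ := Submodule.exists_le_ker_of_lt_top _ (lt_top_iff_ne_top.2 hspan)
    have hwT' (s : V) (hs : s ∈ S) (h : c s = 1) : w s = 0 := hwT (Submodule.subset_span ⟨hs, h⟩)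
    rcases le_total 0 (w v) with h | h
    · exact ⟨w, hw, h, hwT'⟩
    · exact ⟨-w, neg_ne_zero.2 hw, by simpa using h, fun s hs h => by simp [hwT' s hs h]⟩
  obtain ⟨s, hs, hsmin⟩ := Finset.exists_min_image {s ∈ S | 0 < w s} (fun s => (1 - c s) / w s) (by
    obtain ⟨s, hs, hws⟩ := hS w hw
    exact ⟨s, Finset.mem_filter.2 ⟨hs, hws⟩⟩)
  obtain ⟨hs, hws⟩ := Finset.mem_filter.1 hs
  have hcs : c s < 1 := (hcS s hs).lt_of_ne fun h => hws.ne' (hwT s hs h)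
  set t := (1 - c s) / w s with ht
  have ht0 : 0 < t := div_pos (by linarith) hws
  refine hmin (c + t • w) ⟨fun r hr => ?_, ?_⟩ (Finset.card_lt_card
    ((Finset.ssubset_iff_of_subset ?_).2 ⟨s, ?_, ?_⟩))
  · simp only [LinearMap.add_apply, LinearMap.smul_apply, smul_eq_mul]
    rcases le_or_gt (w r) 0 with h | h
    · nlinarith [hcS r hr]
    · have := (le_div_iff₀ h).1 (hsmin r (Finset.mem_filter.2 ⟨hr, h⟩))
      linarith
  · simp only [LinearMap.add_apply, LinearMap.smul_apply, smul_eq_mul]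
    nlinarith
  · intro r hr
    obtain ⟨hr, hlt⟩ := Finset.mem_filter.1 hr
    refine Finset.mem_filter.2 ⟨hr, (hcS r hr).lt_of_ne fun h => ?_⟩
    simp [h, hwT r hr h] at hlt
  · exact Finset.mem_filter.2 ⟨hs, hcs⟩
  · have : t * w s = 1 - c s := div_mul_cancel₀ _ hws.ne'
    simp [this]

theorem exists_facet_of_notMem {d : ℕ} {S : Finset (Fin d → ℝ)} {p x : Fin d → ℝ}
    (hp : p ∈ interior (convexHull ℝ (S : Set (Fin d → ℝ))))
    (hd : pdim (convexHull ℝ (S : Set (Fin d → ℝ))) = d)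
    (hx : x ∉ convexHull ℝ (S : Set (Fin d → ℝ))) :
    ∃ F, IsFacetOf F (convexHull ℝ (S : Set (Fin d → ℝ))) ∧
      ∃ t : ℝ, 0 < t ∧ t < 1 ∧ p + t • (x - p) ∈ affineSpan ℝ F := by
  classical
  set P := convexHull ℝ (S : Set (Fin d → ℝ)) with hP
  have hSP : (S : Set (Fin d → ℝ)) ⊆ P := subset_convexHull _ _
  obtain ⟨f, u, hlt, hu⟩ := geometric_hahn_banach_closed_point
    (convex_convexHull ℝ (S : Set (Fin d → ℝ))) (S.finite_toSet.isCompact_convexHull ℝ).isClosed hx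
  have hfp : 0 < u - f p := sub_pos.2 (hlt p (interior_subset hp))
  obtain ⟨c, hcS, hcx, hspan⟩ := exists_tight_span_eq_top (S := S.image (· - p)) (v := x - p)
    (c₀ := (u - f p)⁻¹ • (f : (Fin d → ℝ) →ₗ[ℝ] ℝ)) (fun w hw => by
      obtain ⟨s, hs, h⟩ := exists_pos_of_mem_interior_convexHull hp hw
      exact ⟨s - p, Finset.mem_image_of_mem _ hs, h⟩) (fun s hs => by
      obtain ⟨s, hs', rfl⟩ := Finset.mem_image.1 hs
      have := hlt s (hSP hs')
      simp only [LinearMap.smul_apply, ContinuousLinearMap.coe_coe, smul_eq_mul, map_sub f]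
      rw [inv_mul_le_iff₀ hfp]
      linarith) (by
      simp only [LinearMap.smul_apply, ContinuousLinearMap.coe_coe, smul_eq_mul, map_sub f]
      rw [lt_inv_mul_iff₀ hfp]
      linarith)
  have hcP (y : Fin d → ℝ) (hy : y ∈ P) : c (y - p) ≤ 1 := by
    have : P ⊆ {y | c y ≤ 1 + c p} := by
      refine convexHull_min (fun s hs => ?_) (convex_halfSpace_le c.isLinear _)
      have := hcS _ (Finset.mem_image_of_mem _ hs)
      rw [map_sub] at this
      exact sub_le_iff_le_add.1 this
    rw [map_sub]
    exact sub_le_iff_le_add.2 (this hy)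
  set F := {y ∈ P | c (y - p) = 1} with hF
  have hface : IsFaceOf F P := by
    have hval (y : Fin d → ℝ) : ((1 + c p) • LinearMap.snd ℝ (Fin d → ℝ) ℝ -
        c ∘ₗ LinearMap.fst ℝ (Fin d → ℝ) ℝ) (y, 1) = 1 - c (y - p) := by
      simp only [LinearMap.sub_apply, LinearMap.smul_apply, LinearMap.snd_apply, smul_eq_mul,
        LinearMap.comp_apply, LinearMap.fst_apply, map_sub]
      ring
    refine isFaceOf_iff.2 ⟨_, fun y hy => (sub_nonneg.2 (hcP y hy)).trans_eq (hval y).symm, ?_⟩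
    ext y
    simp only [hF, mem_ofPred_eq, hval, sub_eq_zero]
    exact and_congr_right fun _ => eq_comm
  obtain ⟨t₀, ht₀⟩ : F.Nonempty := by
    by_contra h
    have : {s | s ∈ S.image (· - p) ∧ c s = 1} = ∅ := by
      refine eq_empty_of_forall_notMem ?_
      rintro _ ⟨hs, hcs⟩
      obtain ⟨s, hs', rfl⟩ := Finset.mem_image.1 hs
      exact h ⟨s, hSP hs', hcs⟩
    rw [this, Submodule.span_empty] at hspan
    have hxp : x - p ∈ (⊥ : Submodule ℝ (Fin d → ℝ)) := hspan ▸ Submodule.mem_top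
    rw [(Submodule.mem_bot ℝ).1 hxp, map_zero] at hcx
    exact absurd hcx (by norm_num)
  have hmem : t₀ ∈ affineSpan ℝ F := subset_affineSpan ℝ F ht₀
  have hdir (v : Fin d → ℝ) : v - c v • (t₀ - p) ∈ (affineSpan ℝ F).direction := by
    have : (⊤ : Submodule ℝ (Fin d → ℝ)) ≤ (affineSpan ℝ F).direction.comap
        (LinearMap.id - c.smulRight (t₀ - p)) := by
      rw [← hspan, Submodule.span_le]
      rintro _ ⟨hs, hcs⟩
      obtain ⟨s, hs', rfl⟩ := Finset.mem_image.1 hs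
      have h := AffineSubspace.vsub_mem_direction
        (subset_affineSpan ℝ F (show s ∈ F from ⟨hSP hs', hcs⟩)) hmem
      simpa [hcs, -map_sub] using h
    exact this Submodule.mem_top
  have hker : (affineSpan ℝ F).direction = LinearMap.ker c := by
    refine le_antisymm ?_ fun v hv => ?_
    · rw [direction_affineSpan, vectorSpan, Submodule.span_le]
      rintro _ ⟨y, hy, z, hz, rfl⟩
      have : y - z = (y - p) - (z - p) := by abel
      simp only [vsub_eq_sub, SetLike.mem_coe, LinearMap.mem_ker]
      rw [this, map_sub c (y - p), hy.2, hz.2, sub_self]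
    · simpa [LinearMap.mem_ker.1 hv] using hdir v
  have hc0 : c ≠ 0 := by
    rintro rfl
    exact absurd hcx (by norm_num)
  refine ⟨F, ⟨hface, ?_⟩, (c (x - p))⁻¹, by positivity, inv_lt_one_of_one_lt₀ hcx, ?_⟩
  · rw [hd, pdim_of_nonempty ⟨t₀, ht₀⟩, hker]
    have := Module.Dual.finrank_ker_add_one_of_ne_zero hc0
    rw [Module.finrank_fin_fun] at this
    exact_mod_cast this
  · have h := AffineSubspace.vadd_mem_of_mem_direction (hdir ((c (x - p))⁻¹ • (x - p))) hmem
    have h1 : (c (x - p))⁻¹ * c (x - p) = 1 := inv_mul_cancel₀ (by positivity)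
    rw [map_smul, smul_eq_mul, h1, one_smul, vadd_eq_add] at h
    convert h using 1
    abel

theorem exists_two_pos_of_dependence_of_facets {d : ℕ} {P : Set (Fin d → ℝ)} {ι : Type*}
    [Fintype ι] {f : ι → ((Fin d → ℝ) × ℝ) →ₗ[ℝ] ℝ} {p : Fin d → ℝ}
    (hp : ∀ i, 0 < f i (p, 1)) (hf : ∀ i, ∀ x ∈ P, 0 ≤ f i (x, 1))
    (hne : ∀ i j, {x ∈ P | f i (x, 1) = 0} ⊆ {x ∈ P | f j (x, 1) = 0} → i = j)
    {l : ι → ℝ} (hl0 : l ≠ 0) (hl : ∀ z, ∑ i, l i * f i z = 0) :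
    ∃ i j, i ≠ j ∧ 0 < l i ∧ 0 < l j := by
  classical
  have hex {l : ι → ℝ} (hl0 : l ≠ 0) (hl : ∀ z, ∑ i, l i * f i z = 0) : ∃ i, 0 < l i := by
    by_contra! h
    refine hl0 (funext fun i => ?_)
    have := (Finset.sum_eq_zero_iff_of_nonpos fun i _ =>
      mul_nonpos_of_nonpos_of_nonneg (h i) (hp i).le).1 (hl (p, 1)) i (Finset.mem_univ i)
    exact (mul_eq_zero.1 this).resolve_right (hp i).ne'
  obtain ⟨i, hi⟩ := hex hl0 hl
  obtain ⟨j, hj⟩ := hex (neg_ne_zero.2 hl0) fun z => by simp [hl]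
  replace hj : l j < 0 := by simpa using hj
  by_contra! h
  have hij : i ≠ j := by
    rintro rfl
    exact lt_asymm hi hj
  refine hij (hne i j ?_)
  rintro x ⟨hx, hxi⟩
  refine ⟨hx, ?_⟩
  have hterm (k : ι) : l k * f k (x, 1) ≤ 0 := by
    by_cases hk : i = k
    · rw [← hk, hxi, mul_zero]
    · exact mul_nonpos_of_nonpos_of_nonneg (h i k hk hi) (hf k x hx)
  have := (Finset.sum_eq_zero_iff_of_nonpos fun k _ => hterm k).1 (hl (x, 1)) j (Finset.mem_univ j)
  exact (mul_eq_zero.1 this).resolve_left hj.ne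

/-- Two facets of a polytope, one contained in the other, coincide. -/
theorem IsFacetOf.eq_of_subset {N : ℕ} {F G P : Set (Fin N → ℝ)} (hF : IsFacetOf F P)
    (hG : IsFacetOf G P) (h : F ⊆ G) : F = G := by
  have hdim : pdim F = pdim G := by linarith [hF.2, hG.2]
  rcases F.eq_empty_or_nonempty with rfl | hFne
  · rcases G.eq_empty_or_nonempty with rfl | hGne
    · rfl
    · rw [pdim_of_nonempty hGne] at hdim
      simp only [pdim, Set.not_nonempty_empty, if_false] at hdim
      omega
  have hGne := hFne.mono h
  rw [pdim_of_nonempty hFne, pdim_of_nonempty hGne] at hdim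
  have hspan : affineSpan ℝ F = affineSpan ℝ G :=
    AffineSubspace.eq_of_direction_eq_of_nonempty_of_le
      (Submodule.eq_of_le_of_finrank_eq (AffineSubspace.direction_le (affineSpan_mono ℝ h))
        (by exact_mod_cast hdim)) ((affineSpan_nonempty ℝ).2 hFne) (affineSpan_mono ℝ h)
  refine h.antisymm fun x hx => ?_
  obtain ⟨f, -, hf⟩ := isFaceOf_iff.1 hF.1
  obtain ⟨g, -, hg⟩ := isFaceOf_iff.1 hG.1
  have hxP : x ∈ P := by
    rw [hg] at hx
    exact hx.1
  have hxF : x ∈ affineSpan ℝ F := hspan ▸ subset_affineSpan ℝ G hx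
  rw [hf]
  exact ⟨hxP, apply_one_eq_zero_of_mem_affineSpan (fun y hy => by rw [hf] at hy; exact hy.2) hxF⟩

theorem snd_pos_of_forall_nonneg {d : ℕ} {P : Set (Fin d → ℝ)} {ι : Type*} [Nonempty ι]
    {f : ι → ((Fin d → ℝ) × ℝ) →ₗ[ℝ] ℝ} {p : Fin d → ℝ} (hbdd : Bornology.IsBounded P)
    (hp : ∀ i, 0 < f i (p, 1)) (hP : ∀ x, (∀ i, 0 ≤ f i (x, 1)) → x ∈ P)
    {z : (Fin d → ℝ) × ℝ} (hz : ∀ i, 0 ≤ f i z) (hz0 : z ≠ 0) : 0 < z.2 := by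
  have hcone {v : Fin d → ℝ} (hv : ∀ i, 0 ≤ f i (v, 0)) : v = 0 := by
    by_contra hv0
    obtain ⟨C, hC⟩ := hbdd.exists_norm_le
    have hC0 : 0 ≤ C := (norm_nonneg p).trans (hC p (hP p fun i => (hp i).le))
    have hvn : 0 < ‖v‖ := norm_pos_iff.2 hv0
    set r := (C + 1 + ‖p‖) / ‖v‖ with hr
    have hr0 : 0 ≤ r := by positivity
    have hmem : p + r • v ∈ P := by
      refine hP _ fun i => ?_
      have : ((p + r • v, 1) : (Fin d → ℝ) × ℝ) = (p, 1) + r • (v, 0) := by simp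
      rw [this, map_add, map_smul, smul_eq_mul]
      exact add_nonneg (hp i).le (mul_nonneg hr0 (hv i))
    have h1 := hC _ hmem
    have h2 : ‖r • v‖ ≤ ‖p + r • v‖ + ‖p‖ := by
      simpa using norm_sub_le (p + r • v) p
    rw [norm_smul, Real.norm_of_nonneg hr0, hr, div_mul_cancel₀ _ hvn.ne'] at h2
    linarith
  by_contra! ht
  have hvert : z.1 - z.2 • p = 0 := by
    refine hcone fun i => ?_
    have : ((z.1 - z.2 • p, 0) : (Fin d → ℝ) × ℝ) = z + (-z.2) • (p, 1) := by
      ext <;> simp [sub_eq_add_neg]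
    rw [this, map_add, map_smul, smul_eq_mul]
    exact add_nonneg (hz i) (mul_nonneg (neg_nonneg.2 ht) (hp i).le)
  have hz' : z = z.2 • (p, 1) := by
    ext1
    · exact sub_eq_zero.1 hvert
    · simp
  obtain ⟨i⟩ := ‹Nonempty ι›
  have h := hz i
  rw [hz', map_smul, smul_eq_mul] at h
  have h2 : z.2 = 0 := ht.antisymm (nonneg_of_mul_nonneg_left h (hp i))
  exact hz0 (by rw [hz', h2, zero_smul])

/-- A full-dimensional polytope is cut out by the inequalities defining its facets. -/
theorem mem_iff_forall_facet {d : ℕ} {P : Set (Fin d → ℝ)} (hP : IsPolytope P)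
    (hd : pdim P = d) {f : {F // IsFacetOf F P} → ((Fin d → ℝ) × ℝ) →ₗ[ℝ] ℝ} {p : Fin d → ℝ}
    (hp : p ∈ interior P) (hp' : ∀ F, 0 < f F (p, 1)) (hf : ∀ F, ∀ x ∈ P, 0 ≤ f F (x, 1))
    (hF : ∀ F : {F // IsFacetOf F P}, F.1 = {x ∈ P | f F (x, 1) = 0}) (x : Fin d → ℝ) :
    x ∈ P ↔ ∀ F, 0 ≤ f F (x, 1) := by
  refine ⟨fun hx F => hf F x hx, fun h => ?_⟩
  by_contra hx
  obtain ⟨S, rfl⟩ := hP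
  obtain ⟨F, hFP, t, ht0, ht1, hmem⟩ := exists_facet_of_notMem hp hd hx
  have hzero := apply_one_eq_zero_of_mem_affineSpan (f := f ⟨F, hFP⟩)
    (fun y hy => ((hF ⟨F, hFP⟩).subset hy).2) hmem
  rw [apply_line_one] at hzero
  have h1 := mul_pos (sub_pos.2 ht1) (hp' ⟨F, hFP⟩)
  have h2 := mul_nonneg ht0.le (h ⟨F, hFP⟩)
  linarith

theorem exists_projEquiv_of_facetCount {d : ℕ} {P : Set (Fin d → ℝ)} (hP : IsPolytope P)
    (hd : pdim P = d) (hcount : facetCount P = d + 2) :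
    ∃ (k n m : ℕ) (h : n + m + k = d), 1 ≤ n ∧ 1 ≤ m ∧
      ProjEquiv P (castSet h (pyrK k (prodP n m))) := by
  classical
  have hfinite : {F | IsFacetOf F P}.Finite := finite_of_ncard_ne_zero (by
    rw [facetCount] at hcount
    omega)
  have : Fintype {F // IsFacetOf F P} := hfinite.fintype
  have hcard : Fintype.card {F // IsFacetOf F P} = d + 2 := by
    rw [← hcount, facetCount, ← Nat.card_eq_fintype_card]
    rfl
  have : Nonempty {F // IsFacetOf F P} := Fintype.card_pos_iff.1 (by omega)
  choose f hf hF using fun F : {F // IsFacetOf F P} => isFaceOf_iff.1 F.2.1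
  obtain ⟨hne, hspan⟩ := affineSpan_eq_top_of_pdim hd
  have hconv : Convex ℝ P := by
    obtain ⟨S, rfl⟩ := hP
    exact convex_convexHull ℝ _
  have hbdd : Bornology.IsBounded P := by
    obtain ⟨S, rfl⟩ := hP
    exact (S.finite_toSet.isCompact_convexHull ℝ).isBounded
  obtain ⟨p, hp⟩ := hconv.interior_nonempty_iff_affineSpan_eq_top.2 hspan
  have hp' (F : {F // IsFacetOf F P}) : 0 < f F (p, 1) := by
    refine (hf F p (interior_subset hp)).lt_of_ne' fun h => ?_
    have hall := apply_one_eq_zero_of_mem_interior hp (hf F) h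
    have hFP : F.1 = P := by
      rw [hF F]
      ext x
      simp [hall]
    have := F.2.2
    rw [hFP] at this
    omega
  have hmem := mem_iff_forall_facet hP hd hp hp' hf hF
  have hpos (z : (Fin d → ℝ) × ℝ) (hz : ∀ F, 0 ≤ f F z) (hz0 : z ≠ 0) : 0 < z.2 :=
    snd_pos_of_forall_nonneg hbdd hp' (fun x => (hmem x).2) hz hz0
  have hinj (z : (Fin d → ℝ) × ℝ) (hz : ∀ F, f F z = 0) : z = 0 := by
    by_contra hz0
    have h1 := hpos z (fun F => (hz F).ge) hz0
    have h2 := hpos (-z) (fun F => by rw [map_neg, hz F, neg_zero]) (neg_ne_zero.2 hz0)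
    simp only [Prod.snd_neg] at h2
    linarith
  have hfin : Module.finrank ℝ ((Fin d → ℝ) × ℝ) = d + 1 := by simp
  obtain ⟨l, hl0, hl⟩ := exists_dual_dependence f (by rw [hfin, hcard]; omega)
  have hsub (F G : {F // IsFacetOf F P})
      (h : {x ∈ P | f F (x, 1) = 0} ⊆ {x ∈ P | f G (x, 1) = 0}) : F = G := by
    rw [← hF F, ← hF G] at h
    exact Subtype.ext (F.2.eq_of_subset G.2 h)
  obtain ⟨k, n, m, rfl, e, hn, hm, hlpos, hlneg, hlzero⟩ := exists_equiv_of_signs hcard l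
    (exists_two_pos_of_dependence_of_facets hp' hf hsub hl0 hl) (by
      simpa using exists_two_pos_of_dependence_of_facets hp' hf hsub (l := -l)
        (neg_ne_zero.2 hl0) fun z => by simpa using hl z)
  refine ⟨k, n, m, rfl, hn, hm, ?_⟩
  have hcast : castSet rfl (pyrK k (prodP n m)) = pyrK k (prodP n m) := by simp [castSet]
  rw [hcast]
  have hprod : (prodP n m).Nonempty :=
    ⟨_, _, subset_convexHull _ _ (.inr rfl), _, subset_convexHull _ _ (.inr rfl), rfl⟩
  let ε : (Option (Fin n) ⊕ Option (Fin m)) ⊕ Fin k → ℝ :=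
    Sum.elim (Sum.elim (fun _ => 1) fun _ => -1) fun _ => 0
  have hex (i : (Option (Fin n) ⊕ Option (Fin m)) ⊕ Fin k) :
      ∃ μ : ℝ, 0 < μ ∧ ε i * μ = l (e i) := by
    rcases i with (i | i) | i
    · exact ⟨l (e (.inl (.inl i))), hlpos i, by simp [ε]⟩
    · exact ⟨-l (e (.inl (.inr i))), by simpa using hlneg i, by simp [ε]⟩
    · exact ⟨1, one_pos, by simp [ε, hlzero]⟩
  choose μ hμ hlμ using hex
  obtain ⟨L, hL⟩ := exists_linearEquiv_of_dual_dependence (f := f ∘ e) (l := l ∘ e)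
    (g := pyrCoord k (prodCoord n m)) (ε := ε)
    (by rw [Fintype.card_congr e, hcard, hfin])
    (fun z hz => hinj z (e.forall_congr_right.1 hz))
    (fun z hz => eq_zero_of_pyrCoord (fun z hz => eq_zero_of_prodCoord hz) hz)
    (fun z => (e.sum_comp fun i => l i * f i z).trans (hl z))
    (fun z => by
      simp only [ε, Fintype.sum_sum_type, Sum.elim_inl, Sum.elim_inr, pyrCoord_inl, one_mul,
        neg_one_mul, zero_mul, Finset.sum_neg_distrib, sum_prodCoord_inl, sum_prodCoord_inr,
        Finset.sum_const_zero, add_zero, add_neg_cancel])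
    (fun h => by simpa [ε] using congrFun h (.inl (.inl none)))
    (fun i => (hμ i).ne') hlμ
  refine projEquiv_of_nonneg (f := f ∘ e) L hμ hL
    (fun x => (hmem x).trans e.forall_congr_right.symm)
    (fun y => mem_pyrK_iff (fun x => mem_prodP_iff) hprod fun z => prodCoord_snd_pos)
    (fun z hz => hpos z (e.forall_congr_right.1 hz))
    (fun z => pyrCoord_snd_pos fun z => prodCoord_snd_pos)

theorem classification_of_dim_plus_two (d : ℕ) (P : Set (Fin d → ℝ))
    (hP : IsPolytope P) (hd : pdim P = d) :
    (vertexCount P = d + 2 →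
      ∃ (k n m : ℕ) (h : n + m + k = d), 1 ≤ n ∧ 1 ≤ m ∧
        ProjEquiv P (castSet h (pyrK k (sumP n m)))) ∧
    (facetCount P = d + 2 →
      ∃ (k n m : ℕ) (h : n + m + k = d), 1 ≤ n ∧ 1 ≤ m ∧
        ProjEquiv P (castSet h (pyrK k (prodP n m)))) := by
  exact ⟨exists_projEquiv_of_vertexCount hP hd, exists_projEquiv_of_facetCount hP hd⟩

end
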